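/- arXiv:2101.01879 — 9 statements merged into one kernel-verified Lean document; each statement's English description precedes it below -/
import Mathlib

section
/- (Iwasawa; Serre) Let p be an odd prime and let u be an even integer with 0 < u < p−1. Then there exists a formal power series F ∈ ℤ_p[[T]] such that for every positive integer k with k ≡ u (mod p−1), the series Σ_{j≥0} F_j·((1+p)^k − 1)^j (where F_j ∈ ℤ_p is the j-th coefficient of F) converges in ℚ_p and its sum equals (1 − p^{k−1})·(−B_k/k). That is, the branch of the p-adic zeta function interpolating the values (1−p^{k−1})ζ(1−k) for k ≡ u (mod p−1) is given by an element of the Iwasawa algebra Λ = ℤ_p[[T]]. -/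
open Filter Topology

lemma aux_teich (p : ℕ) [Fact p.Prime] :
    ∃ c : ℤ_[p], c ^ (p - 1) = 1 ∧ ∀ d : ℕ, (p : ℤ_[p]) ∣ c ^ d - 1 → p - 1 ∣ d := by
  have hp : p.Prime := Fact.out
  obtain ⟨g, hg⟩ := IsCyclic.exists_ofOrder_eq_natCard (α := (ZMod p)ˣ)
  have hcard : orderOf g = p - 1 := by
    rw [hg, Nat.card_eq_fintype_card, ZMod.card_units]
  set a : ℤ_[p] := (((g : ZMod p).val : ℕ) : ℤ_[p]) with ha
  have haz : PadicInt.toZMod a = (g : ZMod p) := by simp [ha]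
  have key : ∀ x : ℤ_[p], (p : ℤ_[p]) ∣ x ↔ PadicInt.toZMod x = 0 := by
    intro x
    rw [← RingHom.mem_ker, PadicInt.ker_toZMod, PadicInt.maximalIdeal_eq_span_p,
      Ideal.mem_span_singleton]
  have hg1 : (g : ZMod p) ^ (p - 1) = 1 := by
    rw [← hcard, ← Units.val_pow_eq_pow_val, pow_orderOf_eq_one, Units.val_one]
  let F : Polynomial ℤ_[p] := Polynomial.X ^ (p - 1) - 1
  have h1 : ‖F.aeval a‖ < 1 := by
    rw [PadicInt.norm_lt_one_iff_dvd, key]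
    simp [F, haz, hg1]
  have h2 : ‖F.derivative.aeval a‖ = 1 := by
    have : ¬ ‖F.derivative.aeval a‖ < 1 := by
      rw [PadicInt.norm_lt_one_iff_dvd, key]
      have h3 : ((p - 1 : ℕ) : ZMod p) ≠ 0 := by
        rw [Ne, ZMod.natCast_eq_zero_iff]
        intro h
        have := Nat.le_of_dvd (by have := hp.two_le; omega) h
        have := hp.two_le
        omega
      simp [F, Polynomial.derivative_X_pow, haz, h3]
    exact le_antisymm (PadicInt.norm_le_one _) (not_lt.mp this)
  obtain ⟨c, hc, hca, -⟩ := hensels_lemma (F := F) (a := a) (by rw [h2]; simpa using h1)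
  rw [h2, PadicInt.norm_lt_one_iff_dvd, key, map_sub, sub_eq_zero, haz] at hca
  refine ⟨c, by simpa [F, sub_eq_zero] using hc, fun d hd => ?_⟩
  rw [key, map_sub, sub_eq_zero, map_pow, hca, map_one] at hd
  rw [← hcard]
  exact orderOf_dvd_of_pow_eq_one (by ext; simpa using hd)

lemma aux_gen (p : ℕ) [Fact p.Prime] (hp2 : p ≠ 2) (c : ℤ_[p]) (hc : c ^ (p - 1) = 1)
    (hc' : ∀ d : ℕ, (p : ℤ_[p]) ∣ c ^ d - 1 → p - 1 ∣ d) (n : ℕ) (j : (ZMod (p ^ (n + 1)))ˣ) :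
    ∃ m : ℕ, PadicInt.toZModPow (n + 1) ((c * (1 + (p : ℤ_[p]))) ^ m) = (j : ZMod (p ^ (n + 1))) := by
  have hp : p.Prime := Fact.out
  have h2 := hp.two_le
  have hpp : 0 < p ^ n := pow_pos hp.pos n
  set C := PadicInt.toZModPow (n + 1) c with hC
  have ord1 : orderOf C = p - 1 := by
    apply Nat.dvd_antisymm
    · apply orderOf_dvd_of_pow_eq_one
      rw [hC, ← map_pow, hc, map_one]
    · apply hc'
      have h : PadicInt.toZModPow (n + 1) (c ^ orderOf C - 1) = 0 := by
        rw [map_sub, map_pow, ← hC, pow_orderOf_eq_one, map_one, sub_self]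
      rw [← RingHom.mem_ker, PadicInt.ker_toZModPow, Ideal.mem_span_singleton] at h
      exact (dvd_pow_self _ (by omega)).trans h
  have ord2 := ZMod.orderOf_one_add_prime hp hp2 n
  have ord : orderOf (C * (1 + p)) = (p - 1) * p ^ n := by
    rw [(Commute.all _ _).orderOf_mul_eq_mul_orderOf_of_coprime, ord1, ord2]
    rw [ord1, ord2]
    apply Nat.Coprime.pow_right
    rw [Nat.coprime_comm]
    exact (Nat.Prime.coprime_iff_not_dvd hp).2 (Nat.not_dvd_of_pos_of_lt (by omega) (by omega))
  have hun : IsUnit (C * (1 + p)) := by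
    apply IsUnit.of_pow_eq_one (pow_orderOf_eq_one _)
    rw [ord]
    exact (Nat.mul_pos (by omega) hpp).ne'
  obtain ⟨y, hy⟩ := hun
  have ordy : orderOf y = Nat.card (ZMod (p ^ (n + 1)))ˣ := by
    rw [← orderOf_units, hy, ord, Nat.card_eq_fintype_card, ZMod.card_units_eq_totient,
      Nat.totient_prime_pow_succ hp, mul_comm]
  have hmem : j ∈ Submonoid.powers y := by
    rw [mem_powers_iff_mem_zpowers]
    have : Subgroup.zpowers y = ⊤ := by
      rw [← Subgroup.card_eq_iff_eq_top, Nat.card_zpowers, ordy]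
    rw [this]; trivial
  obtain ⟨m, hm⟩ := hmem
  refine ⟨m, ?_⟩
  rw [← hm]
  simp [hy, hC]

lemma aux_step (p : ℕ) [Fact p.Prime] (hp2 : p ≠ 2) (c : ℤ_[p]) (hc : c ^ (p - 1) = 1)
    (hc' : ∀ d : ℕ, (p : ℤ_[p]) ∣ c ^ d - 1 → p - 1 ∣ d) (u : ℕ) (hu : 0 < u) (n : ℕ) :
    ∃ G : Polynomial ℤ_[p], ∀ k : ℕ, 0 < k → k ≡ u [MOD p - 1] →
      ∃ r : ℤ_[p], (1 - c ^ u) * ∑ j : (ZMod (p ^ (n + 1)))ˣ,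
          ((j : ZMod (p ^ (n + 1))).val : ℤ_[p]) ^ k =
        k * p ^ (n + 1) * G.eval ((1 + (p : ℤ_[p])) ^ k - 1) + (p ^ (n + 1)) ^ 2 * r := by
  have hp : p.Prime := Fact.out
  choose m hm using aux_gen p hp2 c hc hc' n
  have key : ∀ x y : ℤ_[p], PadicInt.toZModPow (n + 1) x = PadicInt.toZModPow (n + 1) y →
      ∃ t, x = y + p ^ (n + 1) * t := by
    intro x y h
    rw [← sub_eq_zero, ← map_sub, ← RingHom.mem_ker, PadicInt.ker_toZModPow,
      Ideal.mem_span_singleton] at h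
    obtain ⟨t, ht⟩ := h
    exact ⟨t, by rw [← ht]; ring⟩
  have hcu : IsUnit c := IsUnit.of_pow_eq_one hc (by have := hp.two_le; omega)
  have hpu : IsUnit (1 + p : ℤ_[p]) := by
    by_contra h
    have h1 : (p : ℤ_[p]) ∣ 1 + p := by
      rw [← PadicInt.norm_lt_one_iff_dvd]
      exact PadicInt.mem_nonunits.1 h
    have h2 : (p : ℤ_[p]) ∣ 1 := by simpa using h1
    exact PadicInt.prime_p.not_dvd_one h2
  obtain ⟨w, hw⟩ := hpu.exists_right_inv
  let Cu : (ZMod (p ^ (n + 1)))ˣ := (hcu.map (PadicInt.toZModPow (n + 1))).unit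
  have hCu : (Cu : ZMod (p ^ (n + 1))) = PadicInt.toZModPow (n + 1) c := rfl
  let a : (ZMod (p ^ (n + 1)))ˣ → ℤ_[p] := fun j => ((j : ZMod (p ^ (n + 1))).val : ℤ_[p])
  have haz : ∀ j, PadicInt.toZModPow (n + 1) (a j) = (j : ZMod (p ^ (n + 1))) := by
    intro j
    simp only [a, map_natCast]
    have : NeZero (p ^ (n + 1)) := ⟨(pow_pos hp.pos _).ne'⟩
    exact ZMod.natCast_zmod_val _
  have he : ∀ j, ∃ e, a (Cu * j) = c * a j + p ^ (n + 1) * e := by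
    intro j
    apply key
    rw [haz, map_mul, haz, Units.val_mul, hCu]
  choose e he using he
  have ht : ∀ j, ∃ t, a j = (c * (1 + p)) ^ m j + p ^ (n + 1) * t := by
    intro j
    apply key
    rw [haz, hm]
  choose t ht using ht
  refine ⟨∑ j, Polynomial.C (e j * c ^ ((u - 1) * (m j + 1)) * w ^ m j) *
    (1 + Polynomial.X) ^ m j, fun k hk hku => ?_⟩
  have hcpow : ∀ i, c ^ ((u - 1) * i) = c ^ ((k - 1) * i) := by
    intro i
    have h1 : (k - 1) ≡ (u - 1) [MOD p - 1] := by
      apply Nat.ModEq.add_right_cancel' 1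
      rwa [Nat.sub_add_cancel hk, Nat.sub_add_cancel hu]
    have h2 := (h1.mul_right i)
    rw [pow_eq_pow_mod _ hc, ← h2, ← pow_eq_pow_mod _ hc]
  have hck : c ^ u = c ^ k := by
    rw [pow_eq_pow_mod _ hc, ← hku, ← pow_eq_pow_mod _ hc]
  have hterm : ∀ j, ∃ r, a (Cu * j) ^ k = c ^ k * a j ^ k +
      k * p ^ (n + 1) * (e j * c ^ ((u - 1) * (m j + 1)) * w ^ m j * ((1 + p) ^ k) ^ m j) +
      (p ^ (n + 1)) ^ 2 * r := by
    intro j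
    obtain ⟨s, hs⟩ := Polynomial.powAddExpansion (c * a j) (p ^ (n + 1) * e j) k
    obtain ⟨s', hs'⟩ : ∃ s', (c * a j) ^ (k - 1) =
        (c * (c * (1 + p)) ^ m j) ^ (k - 1) + p ^ (n + 1) * s' := by
      have h1 : c * a j - (c * (c * (1 + p)) ^ m j) ∣ (c * a j) ^ (k - 1) -
        (c * (c * (1 + p)) ^ m j) ^ (k - 1) := sub_dvd_pow_sub_pow _ _ _
      have h2 : (p : ℤ_[p]) ^ (n + 1) ∣ c * a j - (c * (c * (1 + p)) ^ m j) :=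
        ⟨c * t j, by rw [ht j]; ring⟩
      obtain ⟨s', h⟩ := h2.trans h1
      exact ⟨s', by rw [← h]; ring⟩
    have hx : c ^ ((u - 1) * (m j + 1)) * w ^ m j * ((1 + p) ^ k) ^ m j =
        (c * (c * (1 + p)) ^ m j) ^ (k - 1) := by
      rw [hcpow]
      obtain ⟨l, rfl⟩ : ∃ l, k = l + 1 := ⟨k - 1, by omega⟩
      rw [Nat.add_sub_cancel]
      have : w ^ m j * (1 + p) ^ m j = 1 := by rw [← mul_pow, mul_comm w, hw, one_pow]
      clear hs hs'
      generalize (1 + p : ℤ_[p]) = q at this ⊢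
      calc _ = c ^ (l * (m j + 1)) * (q ^ m j) ^ l * (w ^ m j * q ^ m j) := by ring
        _ = _ := by rw [this]; ring
    refine ⟨k * s' * e j + s * e j ^ 2, ?_⟩
    rw [he j, hs, hs']
    simp only [mul_assoc] at hx ⊢
    rw [hx]
    ring
  choose r hr using hterm
  refine ⟨∑ j, r j, ?_⟩
  have hperm : ∑ j, a (Cu * j) ^ k = ∑ j, a j ^ k :=
    Equiv.sum_comp (Equiv.mulLeft Cu) (fun j => a j ^ k)
  have hsum : ∑ j, a (Cu * j) ^ k = c ^ k * ∑ j, a j ^ k +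
      k * p ^ (n + 1) * ∑ j, (e j * c ^ ((u - 1) * (m j + 1)) * w ^ m j * ((1 + p) ^ k) ^ m j) +
      (p ^ (n + 1)) ^ 2 * ∑ j, r j := by
    simp only [Finset.mul_sum, ← Finset.sum_add_distrib]
    exact Finset.sum_congr rfl fun j _ => by rw [hr j]
  have hev : (∑ j, Polynomial.C (e j * c ^ ((u - 1) * (m j + 1)) * w ^ m j) *
      (1 + Polynomial.X) ^ m j).eval ((1 + p : ℤ_[p]) ^ k - 1) =
      ∑ j, (e j * c ^ ((u - 1) * (m j + 1)) * w ^ m j * ((1 + p) ^ k) ^ m j) := by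
    rw [Polynomial.eval_finsetSum]
    refine Finset.sum_congr rfl fun j _ => ?_
    rw [Polynomial.eval_mul, Polynomial.eval_C, Polynomial.eval_pow, Polynomial.eval_add,
      Polynomial.eval_X, Polynomial.eval_one, add_sub_cancel]
  rw [hev, hck]
  rw [hperm] at hsum
  change (1 - c ^ k) * ∑ j, a j ^ k = _
  linear_combination hsum

lemma aux_units_sum (p : ℕ) [Fact p.Prime] (n k : ℕ) :
    (∑ j : (ZMod (p ^ (n + 1)))ˣ, ((j : ZMod (p ^ (n + 1))).val : ℚ) ^ k) =
      ∑ a ∈ Finset.range (p ^ (n + 1)), (a : ℚ) ^ k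
        - p ^ k * ∑ a ∈ Finset.range (p ^ n), (a : ℚ) ^ k := by
  have hp : p.Prime := Fact.out
  have : NeZero (p ^ (n + 1)) := ⟨(pow_pos hp.pos _).ne'⟩
  have h1 : (∑ j : (ZMod (p ^ (n + 1)))ˣ, ((j : ZMod (p ^ (n + 1))).val : ℚ) ^ k) =
      ∑ a ∈ (Finset.range (p ^ (n + 1))).filter (fun a => ¬ p ∣ a), (a : ℚ) ^ k := by
    refine Finset.sum_bij (fun j _ => (j : ZMod (p ^ (n + 1))).val) ?_ ?_ ?_ ?_
    · intro j _
      rw [Finset.mem_filter, Finset.mem_range]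
      refine ⟨ZMod.val_lt _, ?_⟩
      have := ZMod.val_coe_unit_coprime j
      rw [Nat.coprime_pow_right_iff (by omega), Nat.coprime_comm] at this
      exact (Nat.Prime.coprime_iff_not_dvd hp).1 this
    · intro j _ j' _ h
      exact Units.ext (ZMod.val_injective _ h)
    · intro b hb
      rw [Finset.mem_filter, Finset.mem_range] at hb
      have hcop : b.Coprime (p ^ (n + 1)) := by
        rw [Nat.coprime_comm]
        exact Nat.Coprime.pow_left _ ((Nat.Prime.coprime_iff_not_dvd hp).2 hb.2)
      refine ⟨ZMod.unitOfCoprime b hcop, Finset.mem_univ _, ?_⟩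
      rw [ZMod.coe_unitOfCoprime, ZMod.val_natCast, Nat.mod_eq_of_lt hb.1]
    · intros; rfl
  have h2 : p ^ k * ∑ a ∈ Finset.range (p ^ n), (a : ℚ) ^ k =
      ∑ a ∈ (Finset.range (p ^ (n + 1))).filter (fun a => p ∣ a), (a : ℚ) ^ k := by
    rw [Finset.mul_sum]
    refine Finset.sum_bij (fun a _ => p * a) ?_ ?_ ?_ ?_
    · intro a ha
      rw [Finset.mem_range] at ha
      rw [Finset.mem_filter, Finset.mem_range, pow_succ']
      exact ⟨Nat.mul_lt_mul_of_pos_left ha hp.pos, dvd_mul_right _ _⟩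
    · intro a _ b _ h
      exact Nat.eq_of_mul_eq_mul_left hp.pos h
    · intro b hb
      rw [Finset.mem_filter, Finset.mem_range, pow_succ'] at hb
      obtain ⟨hb, a, rfl⟩ := hb
      exact ⟨a, Finset.mem_range.2 (Nat.lt_of_mul_lt_mul_left hb), rfl⟩
    · intro a _
      push_cast; ring
  rw [h1, h2, ← Finset.sum_filter_add_sum_filter_not (Finset.range (p ^ (n + 1))) (fun a => p ∣ a)]
  ring

lemma aux_pow_tendsto (p : ℕ) [Fact p.Prime] :
    Tendsto (fun n : ℕ => (p : ℚ_[p]) ^ n) atTop (𝓝 0) :=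
  tendsto_pow_atTop_nhds_zero_of_norm_lt_one Padic.norm_p_lt_one

lemma aux_S (p : ℕ) [Fact p.Prime] (k : ℕ) :
    Tendsto (fun n : ℕ => ((∑ a ∈ Finset.range (p ^ n), (a : ℚ) ^ k : ℚ) : ℚ_[p]) / p ^ n)
      atTop (𝓝 ((bernoulli k : ℚ) : ℚ_[p])) := by
  have hp : p.Prime := Fact.out
  have hp0 : (p : ℚ_[p]) ≠ 0 := by exact_mod_cast hp.ne_zero
  have h1 : ∀ n : ℕ, ((∑ a ∈ Finset.range (p ^ n), (a : ℚ) ^ k : ℚ) : ℚ_[p]) / p ^ n =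
      ∑ i ∈ Finset.range (k + 1), ((bernoulli i : ℚ) : ℚ_[p]) * ((k + 1).choose i) *
        ((p : ℚ_[p]) ^ n) ^ (k - i) / (k + 1) := by
    intro n
    rw [sum_range_pow]
    push_cast
    rw [Finset.sum_div]
    refine Finset.sum_congr rfl fun i hi => ?_
    rw [Finset.mem_range] at hi
    rw [show k + 1 - i = (k - i) + 1 by omega, pow_succ]
    have := pow_ne_zero n hp0
    field_simp
  simp_rw [h1]
  have h2 : ((bernoulli k : ℚ) : ℚ_[p]) =
      ∑ i ∈ Finset.range (k + 1), ((bernoulli i : ℚ) : ℚ_[p]) * ((k + 1).choose i) *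
        (0 : ℚ_[p]) ^ (k - i) / (k + 1) := by
    rw [Finset.sum_range_succ, Finset.sum_eq_zero]
    · have : ((k : ℚ_[p]) + 1) ≠ 0 := by exact_mod_cast Nat.succ_ne_zero k
      simp [Nat.choose_succ_self_right]
      field_simp
    · intro i hi
      rw [Finset.mem_range] at hi
      rw [zero_pow (by omega)]; simp
  rw [h2]
  refine tendsto_finsetSum _ fun i _ => ?_
  exact (((aux_pow_tendsto p).pow _).const_mul _).div_const _

lemma aux_Sstar (p : ℕ) [Fact p.Prime] (k : ℕ) (hk : 0 < k) :
    Tendsto (fun n : ℕ => (∑ j : (ZMod (p ^ (n + 1)))ˣ,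
        ((j : ZMod (p ^ (n + 1))).val : ℚ_[p]) ^ k) / p ^ (n + 1))
      atTop (𝓝 ((1 - (p : ℚ_[p]) ^ (k - 1)) * ((bernoulli k : ℚ) : ℚ_[p]))) := by
  have hp : p.Prime := Fact.out
  have hp0 : (p : ℚ_[p]) ≠ 0 := by exact_mod_cast hp.ne_zero
  have h1 := ((aux_S p k).comp (tendsto_add_atTop_nat 1)).sub
    ((aux_S p k).const_mul ((p : ℚ_[p]) ^ (k - 1)))
  rw [← one_sub_mul] at h1
  refine h1.congr fun n => ?_
  have h2 := congrArg (fun q : ℚ => (q : ℚ_[p])) (aux_units_sum p n k)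
  simp only [Function.comp]
  push_cast at h2 ⊢
  rw [h2]
  obtain ⟨l, rfl⟩ : ∃ l, k = l + 1 := ⟨k - 1, by omega⟩
  rw [Nat.add_sub_cancel]
  field_simp
  ring

lemma aux_limit (p : ℕ) [Fact p.Prime] (G : ℕ → Polynomial ℤ_[p]) :
    ∃ F : PowerSeries ℤ_[p], ∀ x : ℤ_[p], (p : ℤ_[p]) ∣ x → ∀ L : ℚ_[p],
      Tendsto (fun n => (((G n).eval x : ℤ_[p]) : ℚ_[p])) atTop (𝓝 L) →
      HasSum (fun j : ℕ => ((PowerSeries.coeff (R := ℤ_[p]) j F : ℚ_[p]) * (x : ℚ_[p]) ^ j)) L := by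
  let f : ℕ → (ℕ → ℤ_[p]) := fun n j => (G n).coeff j
  let U : Ultrafilter ℕ := hyperfilter ℕ
  obtain ⟨g, -, hg⟩ := isCompact_univ.ultrafilter_le_nhds (U.map f) (by simp)
  have hg' : Tendsto f U (𝓝 g) := hg
  rw [tendsto_pi_nhds] at hg'
  refine ⟨PowerSeries.mk g, fun x hx L hL => ?_⟩
  simp only [PowerSeries.coeff_mk]
  have hxn : ‖(x : ℚ_[p])‖ < 1 := by
    rw [← PadicInt.norm_def]; exact (PadicInt.norm_lt_one_iff_dvd x).2 hx
  have hb : Summable (fun j : ℕ => ‖(x : ℚ_[p])‖ ^ j) :=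
    summable_geometric_of_lt_one (norm_nonneg _) hxn
  have hbd : ∀ (a : ℤ_[p]) (j : ℕ), ‖(a : ℚ_[p]) * (x : ℚ_[p]) ^ j‖ ≤ ‖(x : ℚ_[p])‖ ^ j := by
    intro a j
    rw [norm_mul, norm_pow]
    exact mul_le_of_le_one_left (by positivity) (PadicInt.norm_le_one a)
  have hlim := tendsto_tsum_of_dominated_convergence (𝓕 := (U : Filter ℕ))
    (f := fun n j => ((f n j : ℤ_[p]) : ℚ_[p]) * (x : ℚ_[p]) ^ j)
    (g := fun j => ((g j : ℤ_[p]) : ℚ_[p]) * (x : ℚ_[p]) ^ j) hb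
    (fun j => (((continuous_subtype_val.tendsto _).comp (hg' j)).mul_const _))
    (Eventually.of_forall fun n j => hbd _ _)
  have hev : ∀ n, ∑' j, ((f n j : ℤ_[p]) : ℚ_[p]) * (x : ℚ_[p]) ^ j =
      (((G n).eval x : ℤ_[p]) : ℚ_[p]) := by
    intro n
    rw [tsum_eq_sum (s := Finset.range ((G n).natDegree + 1)), Polynomial.eval_eq_sum_range]
    · rw [PadicInt.coe_sum]
      exact Finset.sum_congr rfl fun j _ => by push_cast; rfl
    · intro j hj
      rw [Finset.mem_range] at hj
      simp [f, Polynomial.coeff_eq_zero_of_natDegree_lt (show (G n).natDegree < j by omega)]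
  simp_rw [hev] at hlim
  have := tendsto_nhds_unique hlim (hL.mono_left Nat.hyperfilter_le_atTop)
  rw [← this]
  exact (Summable.of_norm_bounded hb (fun j => hbd _ _)).hasSum


/-- **(Iwasawa; Serre.)** Let `p` be an odd prime and `u` an even integer with
`0 < u < p - 1`.  There is a power series `F ∈ ℤ_p[[T]]` such that for every positive
integer `k ≡ u (mod p-1)`, evaluating `F` at `(1+p)^k - 1` (the series converges in
`ℚ_p`) gives `(1 - p^(k-1))·ζ(1-k) = (1 - p^(k-1))·(-B_k/k)`. -/
theorem branch_of_p_adic_zeta_in_iwasawa_algebra (p : ℕ) [Fact p.Prime] (hodd : Odd p)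
    (u : ℕ) (hu : 0 < u) (hu' : u < p - 1) (hue : Even u) :
    ∃ F : PowerSeries ℤ_[p],
      ∀ k : ℕ, 0 < k → k ≡ u [MOD p - 1] →
        HasSum
          (fun j : ℕ =>
            ((PowerSeries.coeff (R := ℤ_[p]) j F : ℚ_[p]) * ((1 + (p : ℚ_[p])) ^ k - 1) ^ j))
          ((1 - (p : ℚ_[p]) ^ (k - 1)) * ((-(bernoulli k) / k : ℚ) : ℚ_[p])) := by
  have hp : p.Prime := Fact.out
  have hp2 : p ≠ 2 := by rintro rfl; exact absurd hodd (by decide)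
  have hp0 : (p : ℚ_[p]) ≠ 0 := by exact_mod_cast hp.ne_zero
  obtain ⟨c, hc, hc'⟩ := aux_teich p
  choose G hG using aux_step p hp2 c hc hc' u hu
  have hunit : IsUnit (1 - c ^ u) := by
    by_contra h
    have h1 : (p : ℤ_[p]) ∣ 1 - c ^ u := by
      rw [← PadicInt.norm_lt_one_iff_dvd]
      exact PadicInt.mem_nonunits.1 h
    have h2 := hc' u ((dvd_sub_comm).1 h1)
    have := Nat.le_of_dvd hu h2
    omega
  obtain ⟨v, hv⟩ := hunit.exists_right_inv
  obtain ⟨F, hF⟩ := aux_limit p G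
  refine ⟨PowerSeries.C (-v) * F, fun k hk hku => ?_⟩
  have hk0 : (k : ℚ_[p]) ≠ 0 := by exact_mod_cast hk.ne'
  have hx : (p : ℤ_[p]) ∣ (1 + (p : ℤ_[p])) ^ k - 1 := by
    have := sub_dvd_pow_sub_pow (1 + (p : ℤ_[p])) 1 k
    rwa [add_sub_cancel_left, one_pow] at this
  choose r hr using fun n => hG n k hk hku
  have hL : Tendsto (fun n => (((G n).eval ((1 + (p : ℤ_[p])) ^ k - 1) : ℤ_[p]) : ℚ_[p])) atTop
      (𝓝 (((1 - c ^ u : ℤ_[p]) : ℚ_[p]) / k *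
        ((1 - (p : ℚ_[p]) ^ (k - 1)) * ((bernoulli k : ℚ) : ℚ_[p])) - 0 / k)) := by
    have hz : Tendsto (fun n => (p : ℚ_[p]) ^ (n + 1) * (r n : ℚ_[p])) atTop (𝓝 0) := by
      apply Tendsto.zero_mul_isBoundedUnder_le
      · exact (aux_pow_tendsto p).comp (tendsto_add_atTop_nat 1)
      · exact isBoundedUnder_of ⟨1, fun n => PadicInt.norm_le_one (r n)⟩
    refine (((aux_Sstar p k hk).const_mul _).sub (hz.div_const _)).congr fun n => ?_
    have h := congrArg (fun q : ℤ_[p] => (q : ℚ_[p])) (hr n)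
    simp only [PadicInt.coe_mul, PadicInt.coe_add, PadicInt.coe_sum, PadicInt.coe_pow,
      PadicInt.coe_natCast] at h
    have hpn := pow_ne_zero (n + 1) hp0
    set S := ∑ j : (ZMod (p ^ (n + 1)))ˣ, ((j : ZMod (p ^ (n + 1))).val : ℚ_[p]) ^ k
    set P := (p : ℚ_[p]) ^ (n + 1)
    field_simp
    linear_combination h
  have hs := (hF _ hx _ hL).mul_left (((-v : ℤ_[p])) : ℚ_[p])
  have hv' : ((1 - c ^ u : ℤ_[p]) : ℚ_[p]) * (v : ℚ_[p]) = 1 := by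
    rw [← PadicInt.coe_mul, hv, PadicInt.coe_one]
  have hfun : (fun j : ℕ => ((PowerSeries.coeff (R := ℤ_[p]) j (PowerSeries.C (-v) * F) : ℚ_[p]) *
      ((1 + (p : ℚ_[p])) ^ k - 1) ^ j)) = fun i => (((-v : ℤ_[p])) : ℚ_[p]) *
      ((PowerSeries.coeff (R := ℤ_[p]) i F : ℚ_[p]) * (((1 + (p : ℤ_[p])) ^ k - 1 : ℤ_[p]) : ℚ_[p]) ^ i) := by
    funext j
    rw [PowerSeries.coeff_C_mul]
    push_cast
    ring
  have hval : (1 - (p : ℚ_[p]) ^ (k - 1)) * ((-(bernoulli k) / k : ℚ) : ℚ_[p]) =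
      (((-v : ℤ_[p])) : ℚ_[p]) * (((1 - c ^ u : ℤ_[p]) : ℚ_[p]) / k *
        ((1 - (p : ℚ_[p]) ^ (k - 1)) * ((bernoulli k : ℚ) : ℚ_[p])) - 0 / k) := by
    generalize ((1 - c ^ u : ℤ_[p]) : ℚ_[p]) = d at hv'
    push_cast
    field_simp
    linear_combination ((1 - (p : ℚ_[p]) ^ (k - 1)) * ((bernoulli k : ℚ) : ℚ_[p])) * hv'
  rw [hfun, hval]
  exact hs
end

section
/- (Iwasawa) Let p be an odd prime. Then there exists a formal power series g ∈ ℤ_p[[T]] that is a unit (i.e., its constant coefficient is a unit of ℤ_p) such that, setting F = T·g(T), for every positive integer k divisible by p−1 the series Σ_{j≥0} F_j·((1+p)^k − 1)^j converges in ℚ_p and its sum is the multiplicative inverse of (1 − p^{k−1})·(−B_k/k). That is, the reciprocal of the branch of the p-adic zeta function interpolating (1−p^{k−1})ζ(1−k) for k ≡ 0 (mod p−1) lies in Λ = ℤ_p[[T]] and has the form T·g(T) with g a unit of ℤ_p[[T]]. -/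
open Filter Topology PowerSeries.WithPiTopology

theorem ZB_linTop (p : ℕ) [Fact p.Prime] : IsLinearTopology ℤ_[p] ℤ_[p] := by
  apply IsLinearTopology.mk_of_hasBasis (ι := ℕ) (p := fun _ => True) ℤ_[p]
    (s := fun n : ℕ => (Ideal.span {(p : ℤ_[p]) ^ n} : Ideal ℤ_[p]))
  have hp : 1 < (p:ℝ) := by exact_mod_cast (Fact.out : p.Prime).one_lt
  have := Metric.nhds_basis_closedBall_pow (α := ℤ_[p]) (x := 0) (r := (p:ℝ)⁻¹) (by positivity)
    (inv_lt_one_of_one_lt₀ hp)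
  convert this using 2 with n
  ext x
  simp only [SetLike.mem_coe, ← PadicInt.norm_le_pow_iff_mem_span_pow, mem_closedBall_zero_iff]
  simp [zpow_neg]

theorem ZB_compact (p : ℕ) [Fact p.Prime] : CompactSpace (PowerSeries ℤ_[p]) :=
  inferInstanceAs (CompactSpace ((Unit →₀ ℕ) → ℤ_[p]))

theorem ZB_hasEval (p : ℕ) [Fact p.Prime] (t : ℤ_[p]) (ht : ‖t‖ < 1) : PowerSeries.HasEval t :=
  tendsto_pow_atTop_nhds_zero_of_norm_lt_one ht

theorem ZB_log (p : ℕ) [Fact p.Prime] (hodd : Odd p) (n a : ℕ) (ha : ¬ p ∣ a) :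
    ∃ l : ℕ, (p : ℤ_[p]) ^ (n+1) ∣ (1 + (p : ℤ_[p])) ^ ((p-1) * l) - (a : ℤ_[p]) ^ (p-1) := by
  have hp : p.Prime := Fact.out
  have hp2 : p ≠ 2 := by rintro rfl; exact absurd hodd (by decide)
  have := ZMod.isCyclic_units_of_prime_pow p hp hp2 (n+1)
  have hu : IsUnit (1 + p : ZMod (p ^ (n + 1))) := by
    rw [← Nat.cast_one (R := ZMod _), ← Nat.cast_add, ZMod.isUnit_iff_coprime]
    apply Nat.Coprime.pow_right
    simp
  have ho : orderOf hu.unit = p ^ n := by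
    rw [← orderOf_injective _ Units.coeHom_injective hu.unit, Units.coeHom_apply, IsUnit.unit_spec]
    exact ZMod.orderOf_one_add_prime hp hp2 n
  have hau : IsUnit (a : ZMod (p ^ (n + 1))) := by
    rw [ZMod.isUnit_iff_coprime]
    exact Nat.Coprime.pow_right _ ((Nat.Prime.coprime_iff_not_dvd hp).2 ha).symm
  have hc : (p^n).Coprime (p-1) := by
    apply Nat.Coprime.pow_left
    rw [Nat.Prime.coprime_iff_not_dvd hp]
    intro h
    have := Nat.le_of_dvd (by have := hp.two_le; omega) h
    have := hp.two_le
    omega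
  have ho' : orderOf (hu.unit ^ (p-1)) = p^n := by
    rw [Nat.Coprime.orderOf_pow (by rw [ho]; exact hc), ho]
  have hx : (hau.unit ^ (p-1)) ^ (p^n) = 1 := by
    rw [← pow_mul, mul_comm, ← Nat.totient_prime_pow_succ hp, ZMod.pow_totient]
  have hmem : hau.unit ^ (p-1) ∈ Subgroup.zpowers (hu.unit ^ (p-1)) := by
    have hy : ∀ z ∈ Subgroup.zpowers (hu.unit ^ (p-1)), z ^ (p^n) = 1 := by
      intro z hz
      rw [← ho', ← orderOf_dvd_iff_pow_eq_one]
      exact orderOf_dvd_of_mem_zpowers hz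
    classical
    have hsub : (Finset.univ.filter fun z => z ∈ Subgroup.zpowers (hu.unit ^ (p-1))) ⊆
        Finset.univ.filter fun z : (ZMod (p^(n+1)))ˣ => z ^ (p^n) = 1 := by
      intro z hz
      simp only [Finset.mem_filter, Finset.mem_univ, true_and] at hz ⊢
      exact hy z hz
    have hcard : (Finset.univ.filter fun z => z ∈ Subgroup.zpowers (hu.unit ^ (p-1))).card
        = p^n := by
      rw [← ho', ← Nat.card_zpowers, Nat.card_eq_fintype_card, Fintype.card_subtype]
    have heq := Finset.eq_of_subset_of_card_le hsub (by
      rw [hcard]; exact IsCyclic.card_pow_eq_one_le (pow_pos hp.pos n))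
    have : hau.unit ^ (p-1) ∈ Finset.univ.filter fun z : (ZMod (p^(n+1)))ˣ => z ^ (p^n) = 1 := by
      simp only [Finset.mem_filter, Finset.mem_univ, true_and]; exact hx
    rw [← heq] at this
    simpa using this
  rw [← mem_powers_iff_mem_zpowers] at hmem
  obtain ⟨l, hl⟩ := hmem
  refine ⟨l, ?_⟩
  have hl' := congrArg Units.val hl
  simp only [Units.val_pow_eq_pow_val, IsUnit.unit_spec] at hl'
  rw [← pow_mul] at hl'
  have := (ZMod.intCast_zmod_eq_zero_iff_dvd ((1 + (p:ℤ))^((p-1)*l) - (a:ℤ)^(p-1)) (p^(n+1))).1 (by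
    push_cast
    rw [hl', sub_self])
  have := map_dvd (Int.castRingHom ℤ_[p]) this
  simpa using this

/-- residues prime to p -/
def ZB_U (p n : ℕ) : Finset ℕ := (Finset.range (p^(n+1))).filter fun a => ¬ p ∣ a

theorem ZB_perm (p : ℕ) [Fact p.Prime] (n k : ℕ) :
    ∑ a ∈ ZB_U p n, ((((1+p) * a % p^(n+1) : ℕ) : ℤ)) ^ k = ∑ a ∈ ZB_U p n, (a:ℤ)^k := by
  have hp : p.Prime := Fact.out
  have hpos : 0 < p^(n+1) := pow_pos hp.pos _
  have hmaps : Set.MapsTo (fun a => (1+p) * a % p^(n+1)) (ZB_U p n) (ZB_U p n) := by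
    intro a ha
    simp only [ZB_U, Finset.coe_filter, Finset.mem_range, Set.mem_ofPred_eq] at ha ⊢
    refine ⟨Nat.mod_lt _ hpos, ?_⟩
    rw [Nat.dvd_mod_iff (dvd_pow_self p (by omega)), hp.dvd_mul]
    rintro (h | h)
    · have := (Nat.dvd_add_left (dvd_refl p)).1 h
      exact hp.one_lt.ne' (Nat.dvd_one.1 this)
    · exact ha.2 h
  have hinj : Set.InjOn (fun a => (1+p) * a % p^(n+1)) (ZB_U p n) := by
    intro a ha b hb hab
    simp only [ZB_U, Finset.coe_filter, Finset.mem_range, Set.mem_ofPred_eq] at ha hb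
    have h1 : (1+p) * a ≡ (1+p) * b [MOD p^(n+1)] := hab
    have h2 := Nat.ModEq.cancel_left_of_coprime (by
      apply Nat.Coprime.pow_left
      simp) h1
    exact Nat.ModEq.eq_of_lt_of_lt h2 ha.1 hb.1
  apply Finset.sum_nbij (fun a => (1+p) * a % p^(n+1)) hmaps hinj
  · exact Finset.surjOn_of_injOn_of_card_le _ hmaps hinj le_rfl
  · intros; rfl

theorem ZB_congr (p : ℕ) [Fact p.Prime] (n k : ℕ) (hk : 0 < k) :
    ((p:ℤ)^(n+1))^2 ∣ ((1+(p:ℤ))^k - 1) * (∑ a ∈ ZB_U p n, (a:ℤ)^k) -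
      k * (p:ℤ)^(n+1) * ((1+(p:ℤ))^(k-1) * 
        ∑ a ∈ ZB_U p n, (((1+p) * a / p^(n+1) : ℕ) : ℤ) * (a:ℤ)^(k-1)) := by
  rw [sub_mul, one_mul]
  nth_rw 2 [← ZB_perm]
  simp only [Finset.mul_sum, ← Finset.sum_sub_distrib]
  apply Finset.dvd_sum
  intro a ha
  have h := Nat.mod_add_div ((1+p)*a) (p^(n+1))
  set r := (1+p) * a % p^(n+1)
  set q := (1+p) * a / p^(n+1)
  have h' : (r:ℤ) = (1+(p:ℤ))*a + (-(p:ℤ)^(n+1)*q) := by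
    have := congrArg (Nat.cast : ℕ → ℤ) h
    push_cast at this
    linarith
  obtain ⟨z, hz⟩ := Polynomial.powAddExpansion ((1+(p:ℤ))*a) (-(p:ℤ)^(n+1)*q) k
  rw [h', hz]
  refine ⟨-z*q^2, ?_⟩
  rw [mul_pow, mul_pow]
  ring

theorem ZB_faul (p : ℕ) [Fact p.Prime] (k : ℕ) (hk : 0 < k) :
    Tendsto (fun n : ℕ => (∑ a ∈ Finset.range (p^n), (a:ℚ_[p])^k) / (p:ℚ_[p])^n) atTop
      (𝓝 ((bernoulli k : ℚ) : ℚ_[p])) := by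
  have hp : p.Prime := Fact.out
  have hp0 : (p:ℚ_[p]) ≠ 0 := by exact_mod_cast hp.ne_zero
  have hkk : (k:ℚ_[p]) + 1 ≠ 0 := by exact_mod_cast (Nat.succ_ne_zero k)
  let f : ℚ_[p] → ℚ_[p] := fun x => ∑ i ∈ Finset.range (k+1),
    ((bernoulli i : ℚ) : ℚ_[p]) * ((k+1).choose i) * x^(k-i) / (k+1)
  have hf : Continuous f := by fun_prop
  have hf0 : f 0 = ((bernoulli k : ℚ) : ℚ_[p]) := by
    simp only [f]
    rw [Finset.sum_range_succ, Finset.sum_eq_zero]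
    · simp
      field_simp
    · intro i hi
      rw [Finset.mem_range] at hi
      rw [zero_pow (by omega)]; simp
  have ht : Tendsto (fun n : ℕ => (p:ℚ_[p])^n) atTop (𝓝 0) :=
    tendsto_pow_atTop_nhds_zero_of_norm_lt_one Padic.norm_p_lt_one
  have := (hf.tendsto 0).comp ht
  rw [hf0] at this
  refine this.congr fun n => ?_
  have h := congrArg (Rat.cast : ℚ → ℚ_[p]) (sum_range_pow (p^n) k)
  push_cast at h
  rw [h, Finset.sum_div]
  simp only [Function.comp, f]
  apply Finset.sum_congr rfl
  intro i hi
  rw [Finset.mem_range] at hi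
  rw [show k + 1 - i = (k-i)+1 by omega, pow_succ]
  field_simp

theorem ZB_split (p : ℕ) [Fact p.Prime] (n k : ℕ) :
    ∑ a ∈ ZB_U p n, (a:ℚ_[p])^k = (∑ a ∈ Finset.range (p^(n+1)), (a:ℚ_[p])^k) -
      (p:ℚ_[p])^k * ∑ a ∈ Finset.range (p^n), (a:ℚ_[p])^k := by
  have hp : p.Prime := Fact.out
  rw [← Finset.sum_filter_add_sum_filter_not (Finset.range (p^(n+1))) (fun a => ¬ p ∣ a)]
  rw [ZB_U, eq_sub_iff_add_eq]
  congr 1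
  rw [Finset.mul_sum]
  apply Finset.sum_nbij (fun a => p * a)
  · intro a ha
    simp only [Finset.mem_filter, Finset.mem_range, not_not] at ha ⊢
    exact ⟨by rw [pow_succ']; exact Nat.mul_lt_mul_of_pos_left ha hp.pos, dvd_mul_right _ _⟩
  · intro a _ b _ hab
    exact Nat.eq_of_mul_eq_mul_left hp.pos hab
  · intro b hb
    simp only [Finset.coe_filter, Finset.mem_range, not_not, Set.mem_ofPred_eq] at hb
    obtain ⟨h1, a, rfl⟩ := hb
    refine ⟨a, ?_, rfl⟩
    rw [pow_succ'] at h1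
    simpa using Nat.lt_of_mul_lt_mul_left h1
  · intro a _
    push_cast; ring

theorem ZB_lim (p : ℕ) [Fact p.Prime] (k : ℕ) (hk : 0 < k) :
    Tendsto (fun n : ℕ => (∑ a ∈ ZB_U p n, (a:ℚ_[p])^k) / (p:ℚ_[p])^(n+1)) atTop
      (𝓝 ((1 - (p:ℚ_[p])^(k-1)) * ((bernoulli k : ℚ) : ℚ_[p]))) := by
  have hp : p.Prime := Fact.out
  have hp0 : (p:ℚ_[p]) ≠ 0 := by exact_mod_cast hp.ne_zero
  have h := ZB_faul p k hk
  have h1 := (h.comp (tendsto_add_atTop_nat 1)).sub (h.const_mul ((p:ℚ_[p])^(k-1)))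
  rw [sub_mul, one_mul]
  refine h1.congr fun n => ?_
  rw [ZB_split, sub_div]
  simp only [Function.comp]
  congr 1
  obtain ⟨m, rfl⟩ : ∃ m, k = m+1 := ⟨k-1, by omega⟩
  simp only [Nat.add_sub_cancel]
  field_simp
  ring

theorem ZB_bern (p : ℕ) [Fact p.Prime] (hodd : Odd p) :
    ‖((bernoulli (p-1) : ℚ) : ℚ_[p])‖ = p := by
  have hp : p.Prime := Fact.out
  obtain ⟨m, hm⟩ := hodd
  have hm1 : p - 1 = 2 * m := by omega
  have h2 := hp.two_le
  obtain ⟨z, hz⟩ := Bernoulli.vonStaudt_clausen m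
  have hpm : p ∈ (Finset.range (2 * m + 2)).filter fun q => q.Prime ∧ (q-1) ∣ 2*m := by
    simp only [Finset.mem_filter, Finset.mem_range]
    exact ⟨by omega, hp, by rw [hm1]⟩
  rw [← Finset.add_sum_erase _ _ hpm] at hz
  have hz' := congrArg (Rat.cast : ℚ → ℚ_[p]) hz
  push_cast at hz'
  set s : ℚ_[p] := ∑ x ∈ _, _ with hs
  have hsn : ‖s‖ ≤ 1 := by
    rw [hs]
    apply IsUltrametricDist.norm_sum_le_of_forall_le_of_nonneg zero_le_one
    intro q hq
    simp only [Finset.mem_erase, Finset.mem_filter] at hq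
    rw [norm_div, norm_one]
    have : ‖(q:ℚ_[p])‖ = 1 := by
      rw [Padic.norm_natCast_eq_one_iff]
      exact (Nat.coprime_primes hp hq.2.2.1).2 (Ne.symm hq.1)
    rw [this]; simp
  have hpn : ‖(1:ℚ_[p])/p‖ = p := by simp
  have hB : ((bernoulli (p-1) : ℚ) : ℚ_[p]) = ((z:ℚ_[p]) - s) + (-(1/p)) := by
    rw [hm1, hz']; ring
  have hzs : ‖(z:ℚ_[p]) - s‖ ≤ 1 := by
    rw [sub_eq_add_neg]
    exact (Padic.nonarchimedean _ _).trans
      (max_le (Padic.norm_int_le_one z) (by rw [norm_neg]; exact hsn))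
  have hp1 : (1:ℝ) < p := by exact_mod_cast hp.one_lt
  rw [hB, IsUltrametricDist.norm_add_eq_max_of_norm_ne_norm, norm_neg, hpn, max_eq_right]
  · linarith
  · rw [norm_neg, hpn]; linarith

theorem ZB_cinv (p : ℕ) [Fact p.Prime] : ∃ d : ℤ_[p], (1 + (p:ℤ_[p])) * d = 1 := by
  have hp : p.Prime := Fact.out
  have : ‖((1+p : ℕ) : ℤ_[p])‖ = 1 := by
    rw [PadicInt.norm_natCast_eq_one_iff]; simp
  exact ⟨_, by simpa using PadicInt.mul_inv this⟩

theorem ZB_ainv (p : ℕ) [Fact p.Prime] (a : ℕ) (ha : ¬ p ∣ a) : ∃ d : ℤ_[p], (a:ℤ_[p]) * d = 1 := by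
  have hp : p.Prime := Fact.out
  have : ‖(a : ℤ_[p])‖ = 1 := by
    rw [PadicInt.norm_natCast_eq_one_iff]; exact (Nat.Prime.coprime_iff_not_dvd hp).2 ha
  exact ⟨_, PadicInt.mul_inv this⟩

theorem ZB_tnorm (p : ℕ) [Fact p.Prime] (k : ℕ) : ‖(1 + (p:ℤ_[p]))^k - 1‖ < 1 := by
  rw [PadicInt.norm_lt_one_iff_dvd]
  have := sub_dvd_pow_sub_pow (1 + (p:ℤ_[p])) 1 k
  simpa using this

/-- the level n approximation, and its evaluation -/
theorem ZB_level (p : ℕ) [Fact p.Prime] [IsLinearTopology ℤ_[p] ℤ_[p]] (hodd : Odd p) (n : ℕ) :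
    ∃ H : PowerSeries ℤ_[p], ∀ k : ℕ, 0 < k → (p-1) ∣ k →
      ∃ w : ℤ_[p], (k:ℚ_[p]) *
        (PowerSeries.aeval (ZB_hasEval p _ (ZB_tnorm p k)) H : ℤ_[p]) =
        -((1+(p:ℚ_[p]))^k - 1) * ((∑ a ∈ ZB_U p n, (a:ℚ_[p])^k) / (p:ℚ_[p])^(n+1))
          + (p:ℚ_[p])^(n+1) * w := by
  have hp : p.Prime := Fact.out
  have hp0 : (p:ℚ_[p]) ≠ 0 := by exact_mod_cast hp.ne_zero
  obtain ⟨d, hd⟩ := ZB_cinv p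
  have hl : ∀ a : ℕ, ∃ l : ℕ, ¬ p ∣ a → (p : ℤ_[p]) ^ (n+1) ∣
      (1 + (p : ℤ_[p])) ^ ((p-1) * l) - (a : ℤ_[p]) ^ (p-1) := by
    intro a
    by_cases ha : p ∣ a
    · exact ⟨0, fun h => absurd ha h⟩
    · obtain ⟨l, hl⟩ := ZB_log p hodd n a ha
      exact ⟨l, fun _ => hl⟩
  choose l hl using hl
  have he : ∀ a : ℕ, ∃ e : ℤ_[p], ¬ p ∣ a → (a:ℤ_[p]) * e = 1 := by
    intro a
    by_cases ha : p ∣ a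
    · exact ⟨0, fun h => absurd ha h⟩
    · obtain ⟨l, hl⟩ := ZB_ainv p a ha
      exact ⟨l, fun _ => hl⟩
  choose e he using he
  let q : ℕ → ℕ := fun a => (1+p) * a / p^(n+1)
  refine ⟨-((((1 + Polynomial.X) * Polynomial.C d * ∑ a ∈ ZB_U p n,
    Polynomial.C ((q a : ℤ_[p]) * e a) * (1 + Polynomial.X)^(l a) : Polynomial ℤ_[p])) :
      PowerSeries ℤ_[p]), ?_⟩
  intro k hk hpk
  rw [map_neg, PowerSeries.aeval_coe]
  simp only [map_mul, map_add, map_one, map_sum, map_pow, Polynomial.aeval_X, Polynomial.aeval_C,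
    Algebra.algebraMap_self, RingHom.id_apply, add_sub_cancel]
  -- congruence for the sum
  have h1 : (p:ℤ_[p])^(n+1) ∣ (1+(p:ℤ_[p]))^k * d * (∑ a ∈ ZB_U p n,
      (q a : ℤ_[p]) * e a * ((1+(p:ℤ_[p]))^k)^(l a)) -
      (1+(p:ℤ_[p]))^(k-1) * ∑ a ∈ ZB_U p n, (q a : ℤ_[p]) * (a:ℤ_[p])^(k-1) := by
    have hck : (1+(p:ℤ_[p]))^k * d = (1+(p:ℤ_[p]))^(k-1) := by
      obtain ⟨m, rfl⟩ : ∃ m, k = m+1 := ⟨k-1, by omega⟩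
      rw [pow_succ, mul_assoc, hd, mul_one, Nat.add_sub_cancel]
    rw [hck, ← mul_sub, ← Finset.sum_sub_distrib]
    apply Dvd.dvd.mul_left
    apply Finset.dvd_sum
    intro a ha
    have ha' : ¬ p ∣ a := (Finset.mem_filter.1 ha).2
    have hak : (a:ℤ_[p])^(k-1) = e a * (a:ℤ_[p])^k := by
      obtain ⟨m, rfl⟩ : ∃ m, k = m+1 := ⟨k-1, by omega⟩
      rw [pow_succ, Nat.add_sub_cancel]
      linear_combination -(a:ℤ_[p])^m * he a ha'
    rw [hak, mul_assoc, ← mul_sub, ← mul_sub]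
    apply Dvd.dvd.mul_left
    apply Dvd.dvd.mul_left
    obtain ⟨j, rfl⟩ := hpk
    have := (hl a ha').trans (sub_dvd_pow_sub_pow _ _ j)
    convert this using 2
    · rw [← pow_mul, ← pow_mul]; ring_nf
    · rw [← pow_mul]
  obtain ⟨z, hz⟩ := h1
  obtain ⟨y, hy⟩ := ZB_congr p n k hk
  have hy' := congrArg (Int.cast : ℤ → ℚ_[p]) hy
  simp only [Int.cast_sub, Int.cast_mul, Int.cast_sum, Int.cast_pow, Int.cast_add, Int.cast_one,
    Int.cast_natCast] at hy'
  have hz' := congrArg (PadicInt.Coe.ringHom (p := p)) hz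
  set A := (1+(p:ℤ_[p]))^k * d * (∑ a ∈ ZB_U p n,
      (q a : ℤ_[p]) * e a * ((1+(p:ℤ_[p]))^k)^(l a))
  have hcast : ∀ x : ℤ_[p], PadicInt.Coe.ringHom (p := p) x = (x : ℚ_[p]) := fun _ => rfl
  simp only [map_sub, map_mul, map_sum, map_pow, map_add, map_one, map_natCast] at hz'
  rw [hcast, hcast] at hz'
  refine ⟨(y:ℤ_[p]) - k * z, ?_⟩
  push_cast
  set S := ∑ a ∈ ZB_U p n, (a:ℚ_[p])^k
  set Q : ℚ_[p] := (1+(p:ℚ_[p]))^(k-1) * ∑ a ∈ ZB_U p n, (q a : ℚ_[p]) * (a:ℚ_[p])^(k-1) with hQ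
  have hy2 : ((1+(p:ℚ_[p]))^k - 1) * S - k * (p:ℚ_[p])^(n+1) * Q = ((p:ℚ_[p])^(n+1))^2 * y := by
    rw [← hy', hQ]
  have hP : (p:ℚ_[p])^(n+1) ≠ 0 := pow_ne_zero _ hp0
  set P := (p:ℚ_[p])^(n+1)
  field_simp
  linear_combination (-k*P) * hz' + hy2

theorem ZB_main (p : ℕ) [Fact p.Prime] [IsLinearTopology ℤ_[p] ℤ_[p]] (hodd : Odd p) :
    ∃ H : PowerSeries ℤ_[p], ∀ k : ℕ, 0 < k → (p-1) ∣ k →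
      ((PowerSeries.aeval (ZB_hasEval p _ (ZB_tnorm p k)) H : ℤ_[p]) : ℚ_[p]) =
        ((1+(p:ℚ_[p]))^k - 1) *
          ((1 - (p : ℚ_[p]) ^ (k - 1)) * ((-(bernoulli k) / k : ℚ) : ℚ_[p])) := by
  have hp : p.Prime := Fact.out
  choose H hH using fun n => ZB_level p hodd n
  have := ZB_compact p
  obtain ⟨h, -, hh⟩ := isCompact_univ.exists_mapClusterPt (f := atTop) (u := H) (by simp)
  refine ⟨h, fun k hk hpk => ?_⟩
  have hk0 : (k:ℚ_[p]) ≠ 0 := by exact_mod_cast hk.ne'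
  choose w hw using fun n => hH n k hk hpk
  let φ : PowerSeries ℤ_[p] → ℚ_[p] := fun G =>
    (k:ℚ_[p]) * (PowerSeries.aeval (ZB_hasEval p _ (ZB_tnorm p k)) G : ℤ_[p])
  have hv : Continuous (fun x : ℤ_[p] => (x : ℚ_[p])) := continuous_subtype_val
  have hφ : Continuous φ := continuous_const.mul
    (hv.comp (PowerSeries.continuous_aeval (ZB_hasEval p _ (ZB_tnorm p k))))
  have hcl : MapClusterPt (φ h) atTop (φ ∘ H) := hh.continuousAt_comp hφ.continuousAt
  have hw0 : Tendsto (fun n => (p:ℚ_[p])^(n+1) * (w n : ℚ_[p])) atTop (𝓝 0) := by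
    have ht : Tendsto (fun n : ℕ => ‖(p:ℚ_[p])^(n+1)‖) atTop (𝓝 0) := by
      have := (tendsto_pow_atTop_nhds_zero_of_norm_lt_one
        (Padic.norm_p_lt_one (p := p))).comp (tendsto_add_atTop_nat 1)
      simpa using this.norm
    refine squeeze_zero_norm (fun n => ?_) ht
    rw [norm_mul]
    exact mul_le_of_le_one_right (norm_nonneg _) (w n).2
  have hlim : Tendsto (φ ∘ H) atTop (𝓝 (-((1+(p:ℚ_[p]))^k - 1) *
      ((1 - (p:ℚ_[p])^(k-1)) * ((bernoulli k : ℚ) : ℚ_[p])) + 0)) := by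
    refine (((ZB_lim p k hk).const_mul _).add hw0).congr fun n => ?_
    exact (hw n).symm
  have hne : (𝓝 (φ h) ⊓ 𝓝 (-((1+(p:ℚ_[p]))^k - 1) *
      ((1 - (p:ℚ_[p])^(k-1)) * ((bernoulli k : ℚ) : ℚ_[p])) + 0)).NeBot := ClusterPt.mono hcl hlim
  have heq := eq_of_nhds_neBot hne
  apply mul_left_cancel₀ hk0
  refine heq.trans ?_
  push_cast
  field_simp
  ring

theorem ZB_unit (p : ℕ) [Fact p.Prime] (t : ℤ_[p]) (ht : ‖t‖ < 1)
    [IsLinearTopology ℤ_[p] ℤ_[p]] (h : PowerSeries ℤ_[p]) :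
    IsUnit (PowerSeries.aeval (ZB_hasEval p t ht) h) →
      IsUnit (PowerSeries.constantCoeff h) := by
  intro hu
  by_contra hn
  rw [PadicInt.not_isUnit_iff] at hn
  rw [PadicInt.isUnit_iff] at hu
  have hX : PowerSeries.aeval (ZB_hasEval p t ht) (PowerSeries.X : PowerSeries ℤ_[p]) = t := by
    rw [← Polynomial.coe_X, PowerSeries.aeval_coe, Polynomial.aeval_X]
  have hC : PowerSeries.aeval (ZB_hasEval p t ht) (PowerSeries.C (PowerSeries.constantCoeff h))
      = PowerSeries.constantCoeff h := by
    rw [← Polynomial.coe_C, PowerSeries.aeval_coe, Polynomial.aeval_C]; rfl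
  rw [PowerSeries.eq_X_mul_shift_add_const h, map_add, map_mul, hX, hC] at hu
  have := PadicInt.norm_lt_one_add (z1 := t * PowerSeries.aeval (ZB_hasEval p t ht)
    (PowerSeries.mk fun n => (PowerSeries.coeff (n+1)) h)) (by
      rw [mul_comm]; exact PadicInt.norm_lt_one_mul ht) hn
  exact absurd hu this.ne

theorem ZB_norm (p : ℕ) [Fact p.Prime] (hodd : Odd p) :
    ‖((1+(p:ℚ_[p]))^(p-1) - 1) * ((1 - (p : ℚ_[p]) ^ (p-1 - 1)) *
      ((-(bernoulli (p-1)) / (p-1:ℕ) : ℚ) : ℚ_[p]))‖ = 1 := by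
  have hp : p.Prime := Fact.out
  have h2 := hp.two_le
  have h3 : 3 ≤ p := by
    rcases hodd with ⟨m, hm⟩; omega
  have hpr : (1:ℝ) < p := by exact_mod_cast hp.one_lt
  have hpn : ‖(p:ℚ_[p])‖ < 1 := Padic.norm_p_lt_one
  have hk : ‖((p-1:ℕ):ℚ_[p])‖ = 1 := by
    rw [Padic.norm_natCast_eq_one_iff, Nat.Prime.coprime_iff_not_dvd hp]
    intro h
    have := Nat.le_of_dvd (by omega) h
    omega
  have e1 : ‖(1:ℚ_[p]) - (p : ℚ_[p]) ^ (p-1 - 1)‖ = 1 := by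
    have : ‖-(p : ℚ_[p]) ^ (p-1 - 1)‖ < 1 := by
      rw [norm_neg, norm_pow]
      exact pow_lt_one₀ (norm_nonneg _) hpn (by omega)
    rw [sub_eq_add_neg, IsUltrametricDist.norm_add_eq_max_of_norm_ne_norm, norm_one,
      max_eq_left this.le]
    rw [norm_one]; exact this.ne'
  have e2 : ‖(1+(p:ℚ_[p]))^(p-1) - 1‖ = (p:ℝ)⁻¹ := by
    obtain ⟨z, hz⟩ := Polynomial.powAddExpansion (1:ℤ_[p]) p (p-1)
    have hz' := congrArg (PadicInt.Coe.ringHom (p := p)) hz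
    simp only [map_mul, map_pow, map_add, map_one, map_natCast, one_pow, mul_one] at hz'
    have hz2 : (1+(p:ℚ_[p]))^(p-1) - 1 = p * (((p-1:ℕ):ℚ_[p]) + (z:ℚ_[p]) * p) := by
      rw [hz']
      change _ + (z:ℚ_[p]) * _ - 1 = _
      ring
    have h4 : ‖(z:ℚ_[p]) * p‖ < 1 := by
      rw [norm_mul]
      exact (mul_le_of_le_one_left (norm_nonneg _) z.2).trans_lt hpn
    rw [hz2, norm_mul, IsUltrametricDist.norm_add_eq_max_of_norm_ne_norm, hk, max_eq_left h4.le,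
      Padic.norm_p, mul_one]
    rw [hk]; exact h4.ne'
  push_cast [Rat.cast_div, Rat.cast_neg]
  rw [norm_mul, norm_mul, norm_div, norm_neg, ZB_bern p hodd, e1, e2]
  have hk' := hk
  push_cast [Nat.cast_sub hp.one_le] at hk'
  simp only [Nat.cast_sub hp.one_le, Nat.cast_one, hk']
  field_simp


/-- **(Iwasawa.)** Let `p` be an odd prime.  There is a unit power series
`g ∈ ℤ_p[[T]]ˣ` such that, with `F = T·g(T)`, for every positive integer `k`
divisible by `p - 1`, evaluating `F` at `(1+p)^k - 1` (the series converges in `ℚ_p`)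
gives the multiplicative inverse of `(1 - p^(k-1))·ζ(1-k) = (1 - p^(k-1))·(-B_k/k)`. -/
theorem inverse_zeta_branch_in_iwasawa_algebra (p : ℕ) [Fact p.Prime] (hodd : Odd p) :
    ∃ g : PowerSeries ℤ_[p],
      IsUnit (PowerSeries.constantCoeff (R := ℤ_[p]) g) ∧
      ∀ k : ℕ, 0 < k → (p - 1) ∣ k →
        HasSum
          (fun j : ℕ =>
            ((PowerSeries.coeff (R := ℤ_[p]) j (PowerSeries.X * g) : ℚ_[p]) *
              ((1 + (p : ℚ_[p])) ^ k - 1) ^ j))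
          (((1 - (p : ℚ_[p]) ^ (k - 1)) * ((-(bernoulli k) / k : ℚ) : ℚ_[p]))⁻¹) := by
  have := ZB_linTop p
  have hp : p.Prime := Fact.out
  obtain ⟨h, hh⟩ := ZB_main p hodd
  have hu : IsUnit (PowerSeries.constantCoeff h) := by
    apply ZB_unit p _ (ZB_tnorm p (p-1))
    rw [PadicInt.isUnit_iff, PadicInt.norm_def, hh (p-1) (by have := hp.two_le; omega) dvd_rfl]
    exact ZB_norm p hodd
  obtain ⟨u, hu'⟩ := PowerSeries.isUnit_iff_constantCoeff.2 hu
  refine ⟨(↑u⁻¹ : PowerSeries ℤ_[p]),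
    PowerSeries.isUnit_iff_constantCoeff.1 (Units.isUnit u⁻¹), fun k hk hpk => ?_⟩
  have hev := ZB_hasEval p _ (ZB_tnorm p k)
  have hs := (PowerSeries.hasSum_aeval hev (PowerSeries.X * (↑u⁻¹ : PowerSeries ℤ_[p]))).map
    (PadicInt.Coe.ringHom (p := p)) continuous_subtype_val
  have hX : PowerSeries.aeval hev (PowerSeries.X : PowerSeries ℤ_[p]) = (1+(p:ℤ_[p]))^k - 1 := by
    rw [← Polynomial.coe_X, PowerSeries.aeval_coe, Polynomial.aeval_X]
  convert hs using 1
  · funext j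
    rfl
  have h1 : PowerSeries.aeval hev h * PowerSeries.aeval hev (↑u⁻¹ : PowerSeries ℤ_[p]) = 1 := by
    rw [← map_mul, ← hu', Units.mul_inv, map_one]
  have h2 := congrArg (PadicInt.Coe.ringHom (p := p)) h1
  rw [map_mul, map_one] at h2
  have h3 : PadicInt.Coe.ringHom (p := p) (PowerSeries.aeval hev h) = _ := hh k hk hpk
  rw [h3] at h2
  rw [map_mul, hX, map_mul]
  simp only [map_sub, map_pow, map_add, map_one, map_natCast]
  refine (eq_inv_of_mul_eq_one_left ?_).symm
  linear_combination h2
end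

section
/- Let p be a prime and let F ∈ ℤ_p[[T]] be a nonzero formal power series. Then the set of x ∈ ℚ_p with ‖x‖_p < 1 at which F vanishes, i.e., {x : ℚ_p | ‖x‖_p < 1 and the series Σ_{j≥0} F_j·x^j converges to 0}, is finite. -/
noncomputable def evPS (p : ℕ) [Fact p.Prime] (F : PowerSeries ℤ_[p]) (x : ℚ_[p]) : ℚ_[p] :=
  ∑' j : ℕ, (PowerSeries.coeff (R := ℤ_[p]) j F : ℚ_[p]) * x ^ j

theorem evPS_summable_norm (p : ℕ) [Fact p.Prime] (F : PowerSeries ℤ_[p]) (x : ℚ_[p])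
    (hx : ‖x‖ < 1) :
    Summable (fun j : ℕ => ‖(PowerSeries.coeff (R := ℤ_[p]) j F : ℚ_[p]) * x ^ j‖) := by
  refine Summable.of_nonneg_of_le (fun _ => norm_nonneg _) (fun j => ?_)
    (summable_geometric_of_lt_one (norm_nonneg x) hx)
  rw [norm_mul, norm_pow]
  exact mul_le_of_le_one_left (by positivity) (PadicInt.norm_le_one _)

theorem evPS_mul (p : ℕ) [Fact p.Prime] (F G : PowerSeries ℤ_[p]) (x : ℚ_[p])
    (hx : ‖x‖ < 1) : evPS p (F * G) x = evPS p F x * evPS p G x := by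
  unfold evPS
  rw [tsum_mul_tsum_eq_tsum_sum_antidiagonal_of_summable_norm
    (evPS_summable_norm p F x hx) (evPS_summable_norm p G x hx)]
  refine tsum_congr fun n => ?_
  rw [PowerSeries.coeff_mul]
  have hs := map_sum (PadicInt.Coe.ringHom (p := p))
    (fun q : ℕ × ℕ => PowerSeries.coeff q.1 F * PowerSeries.coeff q.2 G)
    (Finset.HasAntidiagonal.antidiagonal n)
  refine (congrArg (· * x ^ n) hs).trans ?_
  simp only [map_mul]
  rw [Finset.sum_mul]
  refine Finset.sum_congr rfl fun ij hij => ?_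
  rw [← Finset.HasAntidiagonal.mem_antidiagonal.mp hij, pow_add]
  exact mul_mul_mul_comm _ _ _ _

theorem evPS_poly (p : ℕ) [Fact p.Prime] (f : Polynomial ℤ_[p]) (x : ℚ_[p]) :
    evPS p (f : PowerSeries ℤ_[p]) x = (f.map (algebraMap ℤ_[p] ℚ_[p])).eval x := by
  unfold evPS
  rw [Polynomial.eval_map, Polynomial.eval₂_eq_sum_range,
    tsum_eq_sum (s := Finset.range (f.natDegree + 1))]
  · refine Finset.sum_congr rfl fun i _ => ?_
    rw [Polynomial.coeff_coe]
    rfl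
  · intro j hj
    rw [Polynomial.coeff_coe, Polynomial.coeff_eq_zero_of_natDegree_lt (by simpa using hj)]
    simp

theorem evPS_one (p : ℕ) [Fact p.Prime] (x : ℚ_[p]) : evPS p 1 x = 1 := by
  have := evPS_poly p 1 x
  simpa using this

theorem evPS_C (p : ℕ) [Fact p.Prime] (a : ℤ_[p]) (x : ℚ_[p]) :
    evPS p (PowerSeries.C a) x = a := by
  have := evPS_poly p (Polynomial.C a) x
  rw [Polynomial.coe_C] at this
  rw [this, Polynomial.map_C, Polynomial.eval_C]
  rfl

theorem evPS_finite (p : ℕ) [Fact p.Prime] (v : ℕ) : ∀ (F : PowerSeries ℤ_[p]) (k : ℕ),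
    PowerSeries.coeff k F ≠ 0 → (PowerSeries.coeff k F).valuation = v →
    Set.Finite {x : ℚ_[p] | ‖x‖ < 1 ∧ evPS p F x = 0} := by
  induction v using Nat.strong_induction_on with
  | _ v ih =>
  intro F k hk hv
  have hp0 : (p : ℤ_[p]) ≠ 0 := by exact_mod_cast (Fact.out : p.Prime).ne_zero
  by_cases hF : F.map (IsLocalRing.residue ℤ_[p]) = 0
  · have hdvd : ∀ j, ∃ c, PowerSeries.coeff j F = p * c := by
      intro j
      have h := congrArg (PowerSeries.coeff j) hF
      rw [PowerSeries.coeff_map, map_zero, IsLocalRing.residue_eq_zero_iff,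
        PadicInt.maximalIdeal_eq_span_p, Ideal.mem_span_singleton] at h
      exact h
    choose c hc using hdvd
    have hFG : F = PowerSeries.C (p : ℤ_[p]) * PowerSeries.mk c := by
      ext j
      rw [PowerSeries.coeff_C_mul, PowerSeries.coeff_mk, hc]
    have hck : c k ≠ 0 := by
      intro h
      apply hk
      rw [hc, h, mul_zero]
    have hval : (c k).valuation < v := by
      rw [← hv, hc, PadicInt.valuation_mul hp0 hck, PadicInt.valuation_p]
      omega
    refine (ih _ hval (PowerSeries.mk c) k (by simpa using hck) (by simp)).subset ?_
    rintro x ⟨hx, h0⟩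
    refine ⟨hx, ?_⟩
    rw [hFG, evPS_mul p _ _ x hx, evPS_C] at h0
    refine (mul_eq_zero.mp h0).resolve_left ?_
    exact fun h => hp0 (Subtype.ext h)
  · obtain ⟨f, h, H⟩ := PowerSeries.exists_isWeierstrassFactorization hF
    have hmonic := H.isDistinguishedAt.monic.map (algebraMap ℤ_[p] ℚ_[p])
    refine (Polynomial.finite_setOfPred_isRoot hmonic.ne_zero).subset ?_
    rintro x ⟨hx, h0⟩
    rw [H.eq_mul, evPS_mul p _ _ x hx, evPS_poly] at h0
    refine (mul_eq_zero.mp h0).resolve_right fun hh => ?_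
    obtain ⟨g, hg⟩ := H.isUnit.exists_right_inv
    have := evPS_mul p h g x hx
    rw [hg, evPS_one, hh, zero_mul] at this
    exact one_ne_zero this

/-- A nonzero power series `F ∈ ℤ_p[[T]]` has only finitely many zeroes `x ∈ ℚ_p`
with `‖x‖_p < 1` (a consequence of the Weierstrass preparation theorem). -/
theorem finite_zeroes_of_power_series (p : ℕ) [Fact p.Prime]
    (F : PowerSeries ℤ_[p]) (hF : F ≠ 0) :
    Set.Finite {x : ℚ_[p] | ‖x‖ < 1 ∧
      HasSum (fun j : ℕ => (PowerSeries.coeff (R := ℤ_[p]) j F : ℚ_[p]) * x ^ j) 0} := by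
  obtain ⟨k, hk⟩ := PowerSeries.exists_coeff_ne_zero_iff_ne_zero.mpr hF
  refine (evPS_finite p _ F k hk rfl).subset ?_
  rintro x ⟨hx, h⟩
  exact ⟨hx, h.tsum_eq⟩
end

section
/- Let p be an odd prime and let Γ = 1 + pℤ_p = {x ∈ ℤ_p : ‖x − 1‖_p ≤ p^{-1}}, with the subspace topology. Let μ and μ' be ℤ_p-linear maps from the space C(Γ, ℤ_p) of continuous ℤ_p-valued functions on Γ to ℤ_p. If there is an infinite set S of natural numbers such that μ and μ' agree on the monomial function x ↦ x^k for every k ∈ S, then μ = μ'. In other words, a ℤ_p-valued measure on Γ is completely determined by its values on the characters x ↦ x^k for k in any infinite set. -/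
open Polynomial

lemma aux_dvd_of_norm (p : ℕ) [Fact p.Prime] (a b : ℤ_[p]) (hb : b ≠ 0) (h : ‖a‖ ≤ ‖b‖) :
    ∃ d : ℤ_[p], a = b * d ∧ ‖d‖ * ‖b‖ = ‖a‖ := by
  have hb' : (b : ℚ_[p]) ≠ 0 := by simpa using hb
  have hn : ‖(a : ℚ_[p]) / b‖ ≤ 1 := by
    rw [norm_div]
    exact div_le_one_of_le₀ h (norm_nonneg _)
  obtain ⟨d, hd⟩ : ∃ d : ℤ_[p], (d : ℚ_[p]) = (a : ℚ_[p]) / b := ⟨⟨_, hn⟩, rfl⟩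
  have e : a = b * d := by
    apply PadicInt.ext
    rw [PadicInt.coe_mul, hd]
    field_simp
  refine ⟨d, e, ?_⟩
  conv_rhs => rw [e, norm_mul, mul_comm]

lemma aux_factorial_dvd (p : ℕ) [Fact p.Prime] (hodd : Odd p) (j : ℕ) :
    ((j.factorial : ℕ) : ℤ_[p]) ∣ (p : ℤ_[p]) ^ (j / 2) := by
  have hp : p.Prime := Fact.out
  have hp2 : 2 ≤ p - 1 := by
    have := hp.two_le
    rcases hodd with ⟨k, hk⟩
    omega
  have hv := sub_one_mul_padicValNat_factorial (p := p) j
  have hv2 : padicValNat p j.factorial ≤ j / 2 := by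
    have : 2 * padicValNat p j.factorial ≤ (p - 1) * padicValNat p j.factorial :=
      Nat.mul_le_mul_right _ hp2
    omega
  obtain ⟨e, n, hn, he⟩ := Nat.exists_eq_pow_mul_and_not_dvd (Nat.factorial_ne_zero j) p hp.ne_one
  have hn0 : n ≠ 0 := by rintro rfl; simp at hn
  have hve : padicValNat p j.factorial = e := by
    rw [he, padicValNat.mul (pow_ne_zero _ hp.ne_zero) hn0, padicValNat.prime_pow,
      padicValNat.eq_zero_of_not_dvd hn, add_zero]
  have hu : IsUnit (n : ℤ_[p]) := by
    rw [PadicInt.isUnit_iff]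
    refine le_antisymm (PadicInt.norm_le_one _) (not_lt.mp ?_)
    rwa [PadicInt.norm_natCast_lt_one_iff]
  rw [he]
  push_cast
  rw [hu.mul_right_dvd]
  exact pow_dvd_pow _ (by omega)

/-- Strassman-type bound. -/
lemma aux_strassman (p : ℕ) [Fact p.Prime] (c : ℕ → ℤ_[p])
    (hc : Filter.Tendsto (fun j => ‖c j‖) Filter.atTop (nhds 0))
    (S : Set ℕ) (hS : S.Infinite)
    (h : ∀ k ∈ S, ∀ M, k < M → ∑ j ∈ Finset.range M, (k.descFactorial j : ℤ_[p]) * c j = 0) :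
    ∀ j, c j = 0 := by
  by_contra! hne
  obtain ⟨j0, hj0⟩ := hne
  have hfin : ∀ i, c i ≠ 0 → {j | ‖c i‖ ≤ ‖c j‖}.Finite := by
    intro i hi
    have := hc.eventually (gt_mem_nhds (norm_pos_iff.mpr hi))
    rw [Filter.eventually_atTop] at this
    obtain ⟨a, ha⟩ := this
    refine (Set.finite_lt_nat a).subset fun j hj => ?_
    by_contra hja
    exact absurd (ha j (not_lt.mp hja)) (not_lt.mpr hj)
  obtain ⟨N0, hN0, hmax0⟩ := Set.exists_max_image _ (fun j => ‖c j‖) (hfin j0 hj0) ⟨j0, le_refl ‖c j0‖⟩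
  have hN0c : c N0 ≠ 0 := norm_pos_iff.mp ((norm_pos_iff.mpr hj0).trans_le hN0)
  have hmax : ∀ j, ‖c j‖ ≤ ‖c N0‖ := by
    intro j
    rcases le_total ‖c j0‖ ‖c j‖ with h1 | h1
    · exact hmax0 j h1
    · exact h1.trans hN0
  obtain ⟨N, hN, hNmax⟩ := Set.exists_max_image _ (fun j => j) (hfin N0 hN0c) ⟨N0, le_refl ‖c N0‖⟩
  have hNc : c N ≠ 0 := norm_pos_iff.mp ((norm_pos_iff.mpr hN0c).trans_le hN)
  have hle : ∀ j, ‖c j‖ ≤ ‖c N‖ := fun j => (hmax j).trans hN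
  have hlt : ∀ j, N < j → ‖c j‖ < ‖c N‖ := by
    intro j hj
    by_contra hcon
    exact absurd (hNmax j (le_trans hN (not_lt.mp hcon))) (not_le.mpr hj)
  choose d hd hdn using fun j => aux_dvd_of_norm p (c j) (c N) hNc (hle j)
  have hdN : d N = 1 := by
    have := hd N
    exact mul_left_cancel₀ hNc (by rw [← this, mul_one])
  have hdz : ∀ j, N < j → PadicInt.toZMod (d j) = 0 := by
    intro j hj
    rw [← RingHom.mem_ker, PadicInt.ker_toZMod, IsLocalRing.mem_maximalIdeal, PadicInt.mem_nonunits]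
    have h1 := hlt j hj
    rw [← hdn j] at h1
    by_contra hcon
    have := le_mul_of_one_le_left (norm_nonneg (c N)) (not_lt.mp hcon)
    linarith
  obtain ⟨T, hTS, hT⟩ := hS.exists_subset_card_eq (N + 1)
  set M := T.sup id + N + 1 with hM
  let P : ℤ_[p][X] := ∑ j ∈ Finset.range M, C (d j) * descPochhammer ℤ_[p] j
  have hPr : ∀ k ∈ T, P.IsRoot (k : ℤ_[p]) := by
    intro k hk
    have h1 := h k (hTS hk) M (by have : k ≤ T.sup id := Finset.le_sup (f := id) hk
                                  omega)
    have h2 : c N * P.eval (k : ℤ_[p]) = 0 := by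
      rw [← h1, eval_finsetSum, Finset.mul_sum]
      refine Finset.sum_congr rfl fun j _ => ?_
      rw [eval_mul, eval_C, descPochhammer_eval_eq_descFactorial, hd j]
      ring
    exact (mul_eq_zero.mp h2).resolve_left hNc
  let Q : ℤ_[p][X] := ∏ k ∈ T, (X - C (k : ℤ_[p]))
  have hQP : Q ∣ P := by
    by_cases hP0 : P = 0
    · rw [hP0]; exact dvd_zero _
    · have h3 := (Multiset.prod_X_sub_C_dvd_iff_le_roots hP0
        (T.val.map (fun k : ℕ => (k : ℤ_[p])))).mpr ?_
      · rw [Multiset.map_map] at h3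
        exact h3
      · rw [Multiset.le_iff_subset (T.nodup.map Nat.cast_injective)]
        intro a ha
        obtain ⟨k, hk, rfl⟩ := Multiset.mem_map.mp ha
        exact (mem_roots hP0).mpr (hPr k hk)
  have hQm : Q.Monic := monic_prod_of_monic _ _ fun k _ => monic_X_sub_C _
  have hQd : Q.natDegree = N + 1 := by
    rw [natDegree_prod_of_monic _ _ fun k _ => monic_X_sub_C _]
    simp only [natDegree_X_sub_C, Finset.sum_const, hT, smul_eq_mul, mul_one]
  have hdvd : Q.map PadicInt.toZMod ∣ P.map PadicInt.toZMod := Polynomial.map_dvd _ hQP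
  have hPm : P.map PadicInt.toZMod = ∑ j ∈ Finset.range (N + 1),
      C (PadicInt.toZMod (d j)) * descPochhammer (ZMod p) j := by
    rw [Polynomial.map_sum]
    simp only [Polynomial.map_mul, map_C, descPochhammer_map]
    symm
    apply Finset.sum_subset
    · intro j hj
      simp only [Finset.mem_range] at *
      omega
    · intro j _ hj
      rw [hdz j (by simpa using hj)]
      simp
  have hcoe : (P.map (PadicInt.toZMod (p := p))).coeff N = 1 := by
    rw [hPm, finsetSum_coeff, Finset.sum_range_succ, Finset.sum_eq_zero, hdN, zero_add]
    · have := monic_descPochhammer (ZMod p) N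
      rw [Monic, leadingCoeff, descPochhammer_natDegree] at this
      simp [this]
    · intro j hj
      rw [coeff_C_mul, coeff_eq_zero_of_natDegree_lt, mul_zero]
      rw [descPochhammer_natDegree]
      simpa using hj
  have hP0 : P.map (PadicInt.toZMod (p := p)) ≠ 0 := by
    intro h0
    rw [h0] at hcoe
    simp at hcoe
  have h4 := natDegree_le_of_dvd hdvd hP0
  rw [hQm.natDegree_map, hQd] at h4
  have h5 : (P.map (PadicInt.toZMod (p := p))).natDegree ≤ N := by
    rw [hPm]
    refine natDegree_sum_le_of_forall_le _ _ fun j hj => ?_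
    refine (natDegree_C_mul_le _ _).trans ?_
    rw [descPochhammer_natDegree]
    simp only [Finset.mem_range] at hj
    omega
  omega

lemma aux_moments (p : ℕ) [Fact p.Prime] (hodd : Odd p) (m : ℕ → ℤ_[p])
    (S : Set ℕ) (hS : S.Infinite)
    (h : ∀ k ∈ S, ∑ j ∈ Finset.range (k + 1), (k.choose j : ℤ_[p]) * (p ^ j * m j) = 0) :
    ∀ j, m j = 0 := by
  have hp : p.Prime := Fact.out
  choose e he using aux_factorial_dvd p hodd
  have key := aux_strassman p (fun j => (p : ℤ_[p]) ^ (j - j / 2) * e j * m j) ?_ S hS ?_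
  · intro j
    have h1 := key j
    have h2 : (p : ℤ_[p]) ^ j * m j = 0 := by
      have : (p : ℤ_[p]) ^ j = p ^ (j - j / 2) * (j.factorial * e j) := by
        rw [← he, ← pow_add]; congr 1; omega
      rw [this]
      linear_combination (j.factorial : ℤ_[p]) * h1
    exact (mul_eq_zero.mp h2).resolve_left (pow_ne_zero _ (by exact_mod_cast hp.ne_zero))
  · have h0 : Filter.Tendsto (fun j : ℕ => ((p : ℝ)⁻¹) ^ (j - j / 2)) Filter.atTop (nhds 0) := by
      refine (tendsto_pow_atTop_nhds_zero_of_lt_one (by positivity)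
        (inv_lt_one_of_one_lt₀ (by exact_mod_cast hp.one_lt))).comp ?_
      refine Filter.tendsto_atTop_mono (f := fun j => j / 2) (fun j => by omega) ?_
      exact Filter.tendsto_atTop.mpr fun b => by
        filter_upwards [Filter.eventually_ge_atTop (2 * b)] with a ha
        omega
    refine squeeze_zero (fun _ => norm_nonneg _) (fun j => ?_) h0
    rw [norm_mul, norm_mul, norm_pow, PadicInt.norm_p]
    have h1 := PadicInt.norm_le_one (e j)
    have h2 := PadicInt.norm_le_one (m j)
    have h3 : 0 ≤ (p : ℝ)⁻¹ ^ (j - j / 2) := by positivity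
    calc _ ≤ (p : ℝ)⁻¹ ^ (j - j / 2) * 1 * 1 := by gcongr
      _ = _ := by ring
  · intro k hk M hM
    rw [← h k hk]
    symm
    have : ∀ j, (k.choose j : ℤ_[p]) * (p ^ j * m j) =
        (k.descFactorial j : ℤ_[p]) * ((p : ℤ_[p]) ^ (j - j / 2) * e j * m j) := by
      intro j
      have : (p : ℤ_[p]) ^ j = p ^ (j - j / 2) * (j.factorial * e j) := by
        rw [← he, ← pow_add]; congr 1; omega
      rw [this, Nat.descFactorial_eq_factorial_mul_choose]
      push_cast
      ring
    simp only [this]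
    apply Finset.sum_subset
    · intro j hj
      simp only [Finset.mem_range] at *
      omega
    · intro j _ hj
      rw [Nat.descFactorial_eq_zero_iff_lt.mpr (by simp at hj; omega)]
      simp

lemma aux_div (p : ℕ) [Fact p.Prime] (f : C(ℤ_[p], ℤ_[p])) (n : ℕ)
    (hf : ‖f‖ ≤ (p : ℝ) ^ (-n : ℤ)) : ∃ g : C(ℤ_[p], ℤ_[p]), f = ((p : ℤ_[p]) ^ n) • g := by
  have hp : p.Prime := Fact.out
  have : ∀ x, ∃ y, f x = (p : ℤ_[p]) ^ n * y := fun x => by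
    have := (PadicInt.norm_le_pow_iff_mem_span_pow (f x) n).mp ((f.norm_coe_le_norm x).trans hf)
    exact Ideal.mem_span_singleton.mp this
  choose g hg using this
  have hemb : Topology.IsClosedEmbedding (fun y : ℤ_[p] => (p : ℤ_[p]) ^ n * y) :=
    Continuous.isClosedEmbedding (by fun_prop)
      (mul_right_injective₀ (pow_ne_zero _ (by exact_mod_cast hp.ne_zero)))
  have hgc : Continuous g := by
    rw [hemb.isEmbedding.continuous_iff]
    convert f.continuous using 1
    funext x
    exact (hg x).symm
  refine ⟨⟨g, hgc⟩, ?_⟩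
  ext1 x
  exact hg x

lemma aux_zero (p : ℕ) [Fact p.Prime] (l : C(ℤ_[p], ℤ_[p]) →ₗ[ℤ_[p]] ℤ_[p])
    (h : ∀ j : ℕ, l ((ContinuousMap.id ℤ_[p]) ^ j) = 0) : l = 0 := by
  have hp : p.Prime := Fact.out
  have hpoly : ∀ P : ℤ_[p][X], l P.toContinuousMap = 0 := by
    intro P
    have : P.toContinuousMap = ∑ j ∈ Finset.range (P.natDegree + 1),
        P.coeff j • (ContinuousMap.id ℤ_[p]) ^ j := by
      ext1 x
      simp [eval_eq_sum_range]
    rw [this, map_sum]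
    simp [h]
  have hmah : ∀ n, l (mahler n) = 0 := by
    intro n
    have : (descPochhammer ℤ_[p] n).toContinuousMap = (n.factorial : ℤ_[p]) • mahler n := by
      ext1 x
      have h1 := Ring.descPochhammer_eq_factorial_smul_choose x n
      rw [nsmul_eq_mul] at h1
      simp only [toContinuousMap_apply, ContinuousMap.smul_apply, mahler_apply, smul_eq_mul]
      rw [← h1, ← descPochhammer_map (Int.castRingHom ℤ_[p]), eval_map, ← aeval_eq_smeval]
      rfl
    have h2 := hpoly (descPochhammer ℤ_[p] n)
    rw [this, map_smul, smul_eq_mul] at h2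
    exact (mul_eq_zero.mp h2).resolve_left (by exact_mod_cast n.factorial_ne_zero)
  ext1 f
  rw [LinearMap.zero_apply]
  have hterm : ∀ (a : ℤ_[p]) n, l (PadicInt.mahlerTerm a n) = 0 := by
    intro a n
    have : (PadicInt.mahlerTerm a n : C(ℤ_[p], ℤ_[p])) = a • mahler n := by
      ext1 x
      simp [PadicInt.mahlerTerm_apply, mul_comm]
    rw [this, map_smul, hmah, smul_zero]
  rw [← norm_le_zero_iff]
  refine le_of_forall_pos_le_add fun ε hε => ?_
  rw [zero_add]
  obtain ⟨n, hn⟩ := PadicInt.exists_pow_neg_lt p hε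
  have hs := (PadicInt.hasSum_mahler f).tendsto_sum_nat
  have hpos : (0 : ℝ) < (p : ℝ) ^ (-n : ℤ) := by
    have : (0 : ℝ) < p := by exact_mod_cast hp.pos
    positivity
  obtain ⟨M, hM⟩ := (Metric.tendsto_atTop.mp hs) _ hpos
  have hM := hM M le_rfl
  rw [dist_comm, dist_eq_norm] at hM
  obtain ⟨g, hg⟩ := aux_div p _ n hM.le
  have h3 : l f = (p : ℤ_[p]) ^ n * l g := by
    have := congrArg l hg
    rw [map_sub, map_sum, Finset.sum_eq_zero (fun i _ => hterm _ i), sub_zero, map_smul] at this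
    exact this
  rw [h3, norm_mul, PadicInt.norm_p_pow]
  calc _ ≤ (p : ℝ) ^ (-n : ℤ) * 1 := by
        gcongr
        exact PadicInt.norm_le_one _
    _ ≤ ε := by rw [mul_one]; exact hn.le

/-- A `ℤ_p`-valued measure on `Γ = 1 + pℤ_p` (i.e. a `ℤ_p`-linear functional on
`C(Γ, ℤ_p)`) is completely determined by its values on the monomial characters
`x ↦ x^k` for `k` ranging over any infinite set of natural numbers. -/
theorem measure_determined_by_monomials (p : ℕ) [Fact p.Prime] (hodd : Odd p)
    (μ μ' : C({x : ℤ_[p] // ‖x - 1‖ ≤ (p : ℝ)⁻¹}, ℤ_[p]) →ₗ[ℤ_[p]] ℤ_[p])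
    (S : Set ℕ) (hS : S.Infinite)
    (h : ∀ k ∈ S,
      μ ⟨fun x => (x : ℤ_[p]) ^ k, (continuous_subtype_val.pow k)⟩ =
      μ' ⟨fun x => (x : ℤ_[p]) ^ k, (continuous_subtype_val.pow k)⟩) :
    μ = μ' := by
  have hp : p.Prime := Fact.out
  have hp0 : (p : ℤ_[p]) ≠ 0 := by exact_mod_cast hp.ne_zero
  let ψ : ℤ_[p] → {x : ℤ_[p] // ‖x - 1‖ ≤ (p : ℝ)⁻¹} := fun t => ⟨1 + p * t, by
    rw [add_sub_cancel_left, norm_mul, PadicInt.norm_p]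
    exact mul_le_of_le_one_right (by positivity) (PadicInt.norm_le_one _)⟩
  have hψc : Continuous ψ := by
    apply Continuous.subtype_mk
    fun_prop
  have hψb : Function.Bijective ψ := by
    constructor
    · intro a b hab
      have := congrArg Subtype.val hab
      exact mul_left_cancel₀ hp0 (add_left_cancel this)
    · rintro ⟨x, hx⟩
      have h1 := (PadicInt.norm_le_pow_iff_mem_span_pow (x - 1) 1).mp (by simpa using hx)
      rw [pow_one] at h1
      obtain ⟨t, ht⟩ := Ideal.mem_span_singleton.mp h1
      exact ⟨t, Subtype.ext (by change 1 + p * t = x; rw [← ht]; ring)⟩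
  let E := Continuous.homeoOfEquivCompactToT2 (f := Equiv.ofBijective ψ hψb) hψc
  let τ : C({x : ℤ_[p] // ‖x - 1‖ ≤ (p : ℝ)⁻¹}, ℤ_[p]) := ⟨E.symm, E.symm.continuous⟩
  have hτψ : ∀ x, ψ (τ x) = x := fun x => E.apply_symm_apply x
  have hτ : ∀ x : {x : ℤ_[p] // ‖x - 1‖ ≤ (p : ℝ)⁻¹}, (x : ℤ_[p]) = 1 + p * τ x := fun x => (congrArg Subtype.val (hτψ x)).symm
  let l : C(ℤ_[p], ℤ_[p]) →ₗ[ℤ_[p]] ℤ_[p] :=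
    { toFun := fun f => (μ - μ') (f.comp τ)
      map_add' := fun f g => by rw [ContinuousMap.add_comp, map_add]
      map_smul' := fun a f => by rw [ContinuousMap.smul_comp, map_smul, RingHom.id_apply] }
  have hl : l = 0 := by
    apply aux_zero
    apply aux_moments p hodd _ S hS
    intro k hk
    have h1 := sub_eq_zero.mpr (h k hk)
    rw [← LinearMap.sub_apply] at h1
    rw [← h1]
    have h2 : (⟨fun x => (x : ℤ_[p]) ^ k, (continuous_subtype_val.pow k)⟩ :
        C({x : ℤ_[p] // ‖x - 1‖ ≤ (p : ℝ)⁻¹}, ℤ_[p])) =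
        (∑ j ∈ Finset.range (k + 1), ((k.choose j : ℤ_[p]) * p ^ j) •
          (ContinuousMap.id ℤ_[p]) ^ j).comp τ := by
      ext1 x
      change (x : ℤ_[p]) ^ k = _
      rw [hτ x, add_comm, add_pow]
      simp only [ContinuousMap.comp_apply, ContinuousMap.sum_apply, ContinuousMap.smul_apply,
        ContinuousMap.pow_apply, ContinuousMap.id_apply, smul_eq_mul]
      refine Finset.sum_congr rfl fun j _ => ?_
      rw [one_pow]
      ring
    rw [h2]
    change _ = l _
    rw [map_sum]
    refine Finset.sum_congr rfl fun j _ => ?_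
    rw [map_smul, smul_eq_mul, mul_assoc]
  rw [← sub_eq_zero]
  ext1 f
  have h3 := congrArg (fun l' => l' (f.comp ⟨ψ, hψc⟩)) hl
  have h4 : (f.comp ⟨ψ, hψc⟩).comp τ = f := by
    ext1 x
    exact congrArg f (hτψ x)
  rw [← h4]
  exact h3
end

section
/- (Katz) Let p be an odd prime, let K be a field complete with respect to a nontrivial nonarchimedean absolute value ‖·‖, equipped with a ℚ_p-algebra structure such that ‖·‖ restricts to the p-adic absolute value on ℚ_p (normalized by ‖p‖ = p^{-1}), and let 𝒪 = {x ∈ K : ‖x‖ ≤ 1} be its valuation ring. Let G be a compact Hausdorff totally disconnected abelian topological group, and assume that for every n ≥ 1 such that G admits an open subgroup of index n, K contains a primitive n-th root of unity. Let χ₀ : G → K^× be a continuous group homomorphism with ‖χ₀(g)‖ = 1 for all g ∈ G. Let μ and μ' be K-linear maps C(G, K) → K satisfying ‖μ(f)‖ ≤ sup_{g∈G} ‖f(g)‖ and ‖μ'(f)‖ ≤ sup_{g∈G} ‖f(g)‖ for all f (i.e., 𝒪-valued measures on G). If μ(χ₀·χ) = μ'(χ₀·χ) for every continuous finite-order character χ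 : G → K^× (i.e., every continuous homomorphism with χ^n = 1 for some n ≥ 1), where χ₀·χ denotes the pointwise product function g ↦ χ₀(g)χ(g), then μ = μ'. -/
theorem aux_span_characters (Q K : Type*) [CommGroup Q] [Finite Q] [Field K]
    (hζ : ∃ ζ : K, IsPrimitiveRoot ζ (Nat.card Q)) :
    Submodule.span K (Set.range (fun φ : Q →* Kˣ => fun q : Q => ((φ q : Kˣ) : K))) = ⊤ := by
  classical
  have : NeZero (Nat.card Q) := ⟨Nat.card_pos.ne'⟩
  have h1 : HasEnoughRootsOfUnity K (Nat.card Q) := ⟨hζ, inferInstance⟩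
  have h2 : HasEnoughRootsOfUnity K (Monoid.exponent Q) :=
    h1.of_dvd K Group.exponent_dvd_nat_card
  have hcard := CommGroup.card_monoidHom_of_hasEnoughRootsOfUnity Q K
  have : Finite (Q →* Kˣ) := Nat.finite_of_card_ne_zero (by rw [hcard]; exact Nat.card_pos.ne')
  have := Fintype.ofFinite (Q →* Kˣ)
  have := Fintype.ofFinite Q
  apply LinearIndependent.span_eq_top_of_card_eq_finrank'
  · have h3 := (linearIndependent_monoidHom Q K).comp
      (fun φ : Q →* Kˣ => (Units.coeHom K).comp φ) (by
        intro a b hab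
        ext q
        exact DFunLike.congr_fun hab q)
    exact h3
  · rw [Module.finrank_fintype_fun_eq_card, ← Nat.card_eq_fintype_card, hcard,
      Nat.card_eq_fintype_card]

/-- **(Katz, first half of Proposition (4.1.2).)**  Let `K` be a complete
nonarchimedean valued `ℚ_p`-algebra field whose norm extends the `p`-adic one, with
valuation ring `𝒪 = {x : ‖x‖ ≤ 1}`.  Let `G` be a compact, Hausdorff, totally
disconnected abelian topological group such that `K` contains a primitive `n`-th root
of unity whenever `G` has an open subgroup of index `n ≥ 1`.  Let `χ₀ : G → K^×` be a
continuous homomorphism with `‖χ₀(g)‖ = 1`.  Then an `𝒪`-valued measure on `G`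
(a `K`-linear functional on `C(G,K)` of operator norm `≤ 1`) is completely determined
by the values `∫_G χ₀·χ dμ` as `χ` ranges over the continuous finite-order characters
of `G`. -/
theorem measure_determined_by_twisted_finite_order_characters
    (p : ℕ) [Fact p.Prime] (hodd : Odd p)
    (K : Type*) [NontriviallyNormedField K] [CompleteSpace K] [IsUltrametricDist K]
    [Algebra ℚ_[p] K] (hK : ∀ x : ℚ_[p], ‖algebraMap ℚ_[p] K x‖ = ‖x‖)
    (G : Type*) [TopologicalSpace G] [CommGroup G] [IsTopologicalGroup G]
    [CompactSpace G] [T2Space G] [TotallyDisconnectedSpace G]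
    (hroots : ∀ n : ℕ, 1 ≤ n →
      (∃ H : Subgroup G, IsOpen (H : Set G) ∧ H.index = n) →
      ∃ ζ : K, IsPrimitiveRoot ζ n)
    (χ₀ : G →* K) (hχ₀cont : Continuous χ₀) (hχ₀norm : ∀ g : G, ‖χ₀ g‖ = 1)
    (μ μ' : C(G, K) →ₗ[K] K)
    (hμ : ∀ f : C(G, K), ‖μ f‖ ≤ ‖f‖) (hμ' : ∀ f : C(G, K), ‖μ' f‖ ≤ ‖f‖)
    (h : ∀ (χ : G →* K) (hχcont : Continuous χ),
      (∃ n : ℕ, 1 ≤ n ∧ ∀ g : G, (χ g) ^ n = 1) →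
      μ ⟨fun g => χ₀ g * χ g, hχ₀cont.mul hχcont⟩ =
        μ' ⟨fun g => χ₀ g * χ g, hχ₀cont.mul hχcont⟩) :
    μ = μ' := by
  classical
  ext f
  rw [← sub_eq_zero, ← norm_le_zero_iff]
  refine le_of_forall_pos_le_add fun ε hε => ?_
  rw [zero_add]
  have hne : ∀ g, χ₀ g ≠ 0 := fun g hg => by
    have := hχ₀norm g
    simp [hg] at this
  let F : G → K := fun g => f g * (χ₀ g)⁻¹
  have hF : Continuous F := f.continuous.mul (hχ₀cont.inv₀ hne)
  have hev : ∀ᶠ x in nhds (1 : G), ∀ g ∈ (Set.univ : Set G), ‖F (g * x) - F g‖ < ε / 2 := by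
    apply isCompact_univ.eventually_forall_of_forall_eventually
    intro y _
    have hc : Continuous fun z : G × G => ‖F (z.2 * z.1) - F z.2‖ := by fun_prop
    exact hc.continuousAt.eventually_lt continuousAt_const (by simpa using half_pos hε)
  obtain ⟨U, hU, hUo, hU1⟩ := eventually_nhds_iff.mp hev
  obtain ⟨N, hN⟩ :=
    ProfiniteGrp.exist_openNormalSubgroup_sub_open_nhds_of_one hUo hU1
  let H : Subgroup G := N.toSubgroup
  have hHo : IsOpen (H : Set G) := N.isOpen'
  have : DiscreteTopology (G ⧸ H) := QuotientGroup.discreteTopology hHo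
  have : Finite (G ⧸ H) := H.quotient_finite_of_isOpen hHo
  have hspan := aux_span_characters (G ⧸ H) K
    (hroots _ Nat.card_pos ⟨H, hHo, rfl⟩)
  have hmk : Continuous (QuotientGroup.mk : G → G ⧸ H) := continuous_quotient_mk'
  let T : ((G ⧸ H) → K) →ₗ[K] C(G, K) :=
    { toFun := fun φ => ⟨fun g => χ₀ g * φ (QuotientGroup.mk g),
        hχ₀cont.mul (continuous_of_discreteTopology.comp hmk)⟩
      map_add' := fun a b => by ext g; simp [mul_add]
      map_smul' := fun c a => by ext g; simp [mul_left_comm] }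
  have hT : (μ - μ') ∘ₗ T = 0 := by
    apply LinearMap.ext_on_range hspan
    intro φ
    have hcont : Continuous (((Units.coeHom K).comp φ).comp (QuotientGroup.mk' H)) :=
      (continuous_of_discreteTopology (f := fun q => ((φ q : Kˣ) : K))).comp hmk
    have := h (((Units.coeHom K).comp φ).comp (QuotientGroup.mk' H)) hcont
      ⟨Nat.card (G ⧸ H), Nat.card_pos, fun g => by
        rw [← map_pow]
        simp [← map_pow, pow_card_eq_one']⟩
    exact sub_eq_zero.mpr this
  let φ : (G ⧸ H) → K := fun q => F q.out
  have hφ : μ (T φ) - μ' (T φ) = 0 := LinearMap.congr_fun hT φ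
  have hnorm : ‖f - T φ‖ ≤ ε / 2 := by
    rw [ContinuousMap.norm_le _ (half_pos hε).le]
    intro g
    obtain ⟨x, hx⟩ := QuotientGroup.mk_out_eq_mul H g
    have h1 := hU x (hN x.2) g trivial
    have h2 : (f - T φ) g = χ₀ g * -(F (g * x) - F g) := by
      change f g - χ₀ g * F ((QuotientGroup.mk g : G ⧸ H).out) = _
      rw [hx]
      have : f g = χ₀ g * F g := by
        simp only [F]
        field_simp [hne g]
      rw [this]; ring
    rw [h2, norm_mul, hχ₀norm, one_mul, norm_neg]
    exact h1.le
  have key : μ f - μ' f = μ (f - T φ) - μ' (f - T φ) := by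
    simp only [map_sub]
    linear_combination hφ
  rw [key]
  have := norm_sub_le (μ (f - T φ)) (μ' (f - T φ))
  have := hμ (f - T φ)
  have := hμ' (f - T φ)
  linarith
end

section
/- Let p be an odd prime, let d ≥ 1 be an integer, and let c be an integer coprime to d·p. For each integer n ≥ 0 set D_n = d·p^{n+1}, and for an integer a coprime to d·p define the rational number E_c,n(a) := {a/D_n} − c·{c'_n·a/D_n} + (c−1)/2, where c'_n is any integer with c·c'_n ≡ 1 (mod D_n) and {·} denotes the fractional part. Then: (i) E_c,n(a) is independent of the choice of c'_n and depends only on the residue of a modulo D_n, and E_c,n(a) is p-integral (its p-adic valuation is nonnegative); and (ii) for every integer a coprime to d·p and every n ≥ 0, E_c,n(a) = Σ_{j=0}^{p−1} E_c,n+1(a + j·D_n). Consequently the E_c,n assemble into a ℤ_p-valued measure E_c on the profinite group X = lim_n (ℤ/(d·p^{n+1})ℤ)^×. -/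
/-- The regularized Bernoulli datum `E_{c,n}(a) = {a/D_n} - c·{c'·a/D_n} + (c-1)/2`
with `D_n = d·p^(n+1)`, where `c'` is an inverse of `c` modulo `D_n` and `{·}` is the
fractional part. -/
noncomputable def Ecn (p d : ℕ) (c : ℤ) (n : ℕ) (c' a : ℤ) : ℚ :=
  Int.fract ((a : ℚ) / (d * p ^ (n + 1))) -
    c * Int.fract (((c' * a : ℤ) : ℚ) / (d * p ^ (n + 1))) + (c - 1) / 2

theorem fract_congr_aux (D : ℤ) (hD : D ≠ 0) (a b : ℤ) (h : a ≡ b [ZMOD D]) :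
    Int.fract ((a : ℚ) / D) = Int.fract ((b : ℚ) / D) := by
  obtain ⟨k, hk⟩ := h.dvd
  have hD' : (D : ℚ) ≠ 0 := by exact_mod_cast hD
  have : (b : ℚ) / D = (a : ℚ) / D + k := by
    have : (b : ℚ) = a + D * k := by
      have : b = a + D * k := by linarith
      exact_mod_cast this
    rw [this]; field_simp
  rw [this, Int.fract_add_intCast]

theorem fract_sum_aux (p : ℕ) (hp : 0 < p) (u : ℤ) (hu : IsCoprime u (p : ℤ)) (x : ℚ) :
    ∑ j ∈ Finset.range p, Int.fract ((x + u * j) / p) = Int.fract x + ((p : ℚ) - 1) / 2 := by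
  have hpZ : (0 : ℤ) < p := by exact_mod_cast hp
  have hpQ : (0 : ℚ) < p := by exact_mod_cast hp
  have hmem : ∀ j : ℕ, ((u * j + ⌊x⌋) % p).toNat ∈ Finset.range p := by
    intro j
    have h1 := Int.emod_nonneg (u * j + ⌊x⌋) hpZ.ne'
    have h2 := Int.emod_lt_of_pos (u * j + ⌊x⌋) hpZ
    rw [Finset.mem_range]
    omega
  have hinj : Set.InjOn (fun j : ℕ => ((u * j + ⌊x⌋) % p).toNat) (Finset.range p : Set ℕ) := by
    intro i hi j hj hij
    simp only [Finset.coe_range, Set.mem_Iio] at hi hj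
    have h1 := Int.emod_nonneg (u * i + ⌊x⌋) hpZ.ne'
    have h2 := Int.emod_nonneg (u * j + ⌊x⌋) hpZ.ne'
    have h3 : (u * i + ⌊x⌋) % p = (u * j + ⌊x⌋) % p := by
      simp only at hij
      omega
    have h4 : (p : ℤ) ∣ u * ((j : ℤ) - i) := by
      have := Int.ModEq.dvd (show u * i + ⌊x⌋ ≡ u * j + ⌊x⌋ [ZMOD p] from h3)
      convert this using 1; ring
    have h5 := hu.symm.dvd_of_dvd_mul_left h4
    have h6 := Int.eq_zero_of_abs_lt_dvd h5 (by rw [abs_lt]; constructor <;> omega)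
    omega
  have key : ∑ j ∈ Finset.range p, Int.fract ((x + u * j) / p)
      = ∑ i ∈ Finset.range p, ((Int.fract x + i) / p : ℚ) := by
    refine Finset.sum_nbij (fun j : ℕ => ((u * j + ⌊x⌋) % p).toNat) (fun j _ => hmem j) hinj
      (Finset.surjOn_of_injOn_of_card_le _ (fun j _ => hmem j) hinj le_rfl) ?_
    intro j _
    have h1 := Int.emod_nonneg (u * j + ⌊x⌋) hpZ.ne'
    have h2 := Int.emod_lt_of_pos (u * j + ⌊x⌋) hpZ
    have h3 := Int.emod_add_mul_ediv (u * j + ⌊x⌋) p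
    generalize (u * j + ⌊x⌋) % p = r at *
    generalize (u * j + ⌊x⌋) / (p : ℤ) = q at *
    lift r to ℕ using h1
    have h3' : (r : ℚ) + p * q = u * j + ⌊x⌋ := by exact_mod_cast h3
    have hx := Int.floor_add_fract x
    have hf0 := Int.fract_nonneg x
    have hf1 := Int.fract_lt_one x
    have hr : (r : ℚ) + 1 ≤ p := by
      have : r + 1 ≤ p := by omega
      exact_mod_cast this
    have e : (x + u * j) / p = (Int.fract x + r) / p + (q : ℤ) := by
      field_simp
      linarith
    rw [e, Int.fract_add_intCast, Int.toNat_natCast, Int.fract_eq_self.2]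
    refine ⟨by positivity, ?_⟩
    rw [div_lt_one hpQ]
    linarith
  rw [key, ← Finset.sum_div, Finset.sum_add_distrib]
  have hs : ∀ m : ℕ, ∑ i ∈ Finset.range m, (i : ℚ) = m * (m - 1) / 2 := by
    intro m
    induction m with
    | zero => simp
    | succ k ih => rw [Finset.sum_range_succ, ih]; push_cast; ring
  rw [hs]
  simp only [Finset.sum_const, Finset.card_range, nsmul_eq_mul]
  field_simp

/-- The data `E_{c,n}` assemble into a `ℤ_p`-valued measure on
`X = lim_n (ℤ/(d·p^(n+1))ℤ)^×`: (i) `E_{c,n}(a)` is independent of the choice of the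
inverse `c'` of `c` mod `D_n`, depends only on the residue of `a` mod `D_n`, and is
`p`-integral; (ii) `E_{c,n}(a) = Σ_{j=0}^{p-1} E_{c,n+1}(a + j·D_n)`, the
compatibility making `(E_{c,n})_n` a measure on the inverse limit. -/
theorem Ecn_measure (p : ℕ) (hp : p.Prime) (hodd : Odd p)
    (d : ℕ) (hd : 1 ≤ d) (c : ℤ) (hc : IsCoprime c ((d : ℤ) * p)) :
    -- (i) well-definedness and `p`-integrality
    (∀ (n : ℕ) (c₁ c₂ a b : ℤ),
        c * c₁ ≡ 1 [ZMOD ((d : ℤ) * p ^ (n + 1))] →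
        c * c₂ ≡ 1 [ZMOD ((d : ℤ) * p ^ (n + 1))] →
        a ≡ b [ZMOD ((d : ℤ) * p ^ (n + 1))] →
        Ecn p d c n c₁ a = Ecn p d c n c₂ b) ∧
    (∀ (n : ℕ) (c' a : ℤ),
        c * c' ≡ 1 [ZMOD ((d : ℤ) * p ^ (n + 1))] →
        IsCoprime a ((d : ℤ) * p) →
        0 ≤ padicValRat p (Ecn p d c n c' a)) ∧
    -- (ii) the distribution/measure compatibility relation
    (∀ (n : ℕ) (c' c'' a : ℤ),
        c * c' ≡ 1 [ZMOD ((d : ℤ) * p ^ (n + 1))] →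
        c * c'' ≡ 1 [ZMOD ((d : ℤ) * p ^ (n + 2))] →
        IsCoprime a ((d : ℤ) * p) →
        Ecn p d c n c' a =
          ∑ j ∈ Finset.range p, Ecn p d c (n + 1) c'' (a + j * ((d : ℤ) * p ^ (n + 1)))) := by
  have hp0 : 0 < p := hp.pos
  have hpQ : (p : ℚ) ≠ 0 := by exact_mod_cast hp0.ne'
  have hdQ : (d : ℚ) ≠ 0 := by exact_mod_cast (by omega : d ≠ 0)
  have hD : ∀ n : ℕ, ((d : ℤ) * p ^ (n + 1)) ≠ 0 := by
    intro n
    have : d * p ^ (n + 1) ≠ 0 := Nat.mul_ne_zero (by omega) (pow_ne_zero _ hp0.ne')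
    exact_mod_cast this
  have hinv : ∀ (D c₁ c₂ : ℤ), c * c₁ ≡ 1 [ZMOD D] → c * c₂ ≡ 1 [ZMOD D] →
      c₁ ≡ c₂ [ZMOD D] := by
    intro D c₁ c₂ h1 h2
    calc c₁ = 1 * c₁ := by ring
      _ ≡ (c * c₂) * c₁ [ZMOD D] := (h2.symm).mul_right _
      _ = (c * c₁) * c₂ := by ring
      _ ≡ 1 * c₂ [ZMOD D] := h1.mul_right _
      _ = c₂ := by ring
  have hcongr : ∀ (n : ℕ) (a b : ℤ), a ≡ b [ZMOD ((d : ℤ) * p ^ (n + 1))] →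
      Int.fract ((a : ℚ) / (d * p ^ (n + 1))) = Int.fract ((b : ℚ) / (d * p ^ (n + 1))) := by
    intro n a b h
    have := fract_congr_aux _ (hD n) a b h
    push_cast at this
    exact this
  refine ⟨?_, ?_, ?_⟩
  · intro n c₁ c₂ a b h1 h2 hab
    unfold Ecn
    rw [hcongr n a b hab, hcongr n _ _ ((hinv _ _ _ h1 h2).mul hab)]
  · intro n c' a h1 _
    have : Fact p.Prime := ⟨hp⟩
    obtain ⟨k, hk⟩ := h1.dvd
    obtain ⟨m, hm⟩ : ∃ m : ℤ, Ecn p d c n c' a = (m : ℚ) / 2 := by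
      have hk' : (1 : ℚ) - c * c' = d * p ^ (n + 1) * k := by exact_mod_cast hk
      refine ⟨2 * (a * k - ⌊(a : ℚ) / (d * p ^ (n + 1))⌋
        + c * ⌊((c' * a : ℤ) : ℚ) / (d * p ^ (n + 1))⌋) + (c - 1), ?_⟩
      unfold Ecn Int.fract
      have e : (a : ℚ) / (d * p ^ (n + 1)) - c * (((c' * a : ℤ) : ℚ) / (d * p ^ (n + 1)))
          = a * k := by
        have hDQ : (d : ℚ) * p ^ (n + 1) ≠ 0 := by positivity
        push_cast
        rw [← mul_div_assoc, ← sub_div, div_eq_iff hDQ]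
        linear_combination (a : ℚ) * hk'
      push_cast at e ⊢
      linear_combination e
    rw [hm]
    by_cases hm0 : m = 0
    · simp [hm0]
    · have h2 : padicValRat p (2 : ℚ) = 0 := by
        have : padicValNat p 2 = 0 := by
          apply padicValNat.eq_zero_of_not_dvd
          intro h
          have := (Nat.prime_dvd_prime_iff_eq hp Nat.prime_two).1 h
          subst this
          exact absurd hodd (by decide)
        have h := padicValRat.of_nat (p := p) (n := 2)
        rw [this] at h
        exact_mod_cast h
      rw [padicValRat.div (by exact_mod_cast hm0) two_ne_zero, h2, padicValRat.of_int]
      simp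
  · intro n c' c'' a h1 h2 _
    have hdvd : ((d : ℤ) * p ^ (n + 1)) ∣ ((d : ℤ) * p ^ (n + 2)) := ⟨p, by ring⟩
    have hcc : c' ≡ c'' [ZMOD ((d : ℤ) * p ^ (n + 1))] := hinv _ _ _ h1 (h2.of_dvd hdvd)
    have hcop : IsCoprime c'' (p : ℤ) := by
      obtain ⟨k, hk⟩ := h2.dvd
      exact ⟨c, d * p ^ (n + 1) * k, by linear_combination -hk⟩
    have s1 := fract_sum_aux p hp0 1 isCoprime_one_left ((a : ℚ) / (d * p ^ (n + 1)))
    have s2 := fract_sum_aux p hp0 c'' hcop (((c'' * a : ℤ) : ℚ) / (d * p ^ (n + 1)))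
    unfold Ecn
    rw [Finset.sum_add_distrib, Finset.sum_sub_distrib, ← Finset.mul_sum,
      hcongr n (c' * a) (c'' * a) (hcc.mul_right _)]
    have t1 : ∑ j ∈ Finset.range p, Int.fract
        (((a + j * ((d : ℤ) * p ^ (n + 1)) : ℤ) : ℚ) / (d * p ^ (n + 1 + 1)))
        = Int.fract ((a : ℚ) / (d * p ^ (n + 1))) + ((p : ℚ) - 1) / 2 := by
      rw [← s1]
      refine Finset.sum_congr rfl fun j _ => ?_
      congr 1
      push_cast
      field_simp
      ring
    have t2 : ∑ j ∈ Finset.range p, Int.fract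
        (((c'' * (a + j * ((d : ℤ) * p ^ (n + 1))) : ℤ) : ℚ) / (d * p ^ (n + 1 + 1)))
        = Int.fract (((c'' * a : ℤ) : ℚ) / (d * p ^ (n + 1))) + ((p : ℚ) - 1) / 2 := by
      rw [← s2]
      refine Finset.sum_congr rfl fun j _ => ?_
      congr 1
      push_cast
      field_simp
      ring
    rw [t1, t2]
    simp only [Finset.sum_const, Finset.card_range, nsmul_eq_mul]
    ring
end

section
/- Let k ≥ 1 be an integer. For all positive integers i, j with j dividing i, and every integer a, one has j^{k−1}·B_k({a/j}) = i^{k−1}·Σ_{b=0}^{(i/j)−1} B_k({(a + b·j)/i}). That is, the family of functions φ_i : (1/i)ℤ/ℤ → ℚ, φ_i(a/i) = i^{k−1}·B_k({a/i}), is a distribution on lim_i (1/i)ℤ/ℤ (the k-th Bernoulli distribution). -/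
open Polynomial in
theorem bd_const (P : ℚ[X]) (h : ∀ x, P.eval (x + 1) = P.eval x) : P = C (P.eval 0) := by
  apply Polynomial.eq_of_infinite_eval_eq
  apply Set.Infinite.mono (s := Set.range (fun n : ℕ => (n : ℚ)))
  · rintro _ ⟨n, rfl⟩
    simp only [Set.mem_setOf_eq, eval_C]
    induction n with
    | zero => simp
    | succ n ih => push_cast; rw [h, ih]
  · exact Set.infinite_range_of_injective Nat.cast_injective

open Polynomial in
noncomputable def bdG (n k : ℕ) : ℚ[X] :=
  C ((n : ℚ) ^ k) * ∑ b ∈ Finset.range n,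
    (Polynomial.bernoulli k).comp (C ((n : ℚ)⁻¹) * (X + C (b : ℚ))) - C (n : ℚ) * Polynomial.bernoulli k

open Polynomial in
theorem bdG_per (n k : ℕ) (hn : 0 < n) (x : ℚ) : (bdG n k).eval (x + 1) = (bdG n k).eval x := by
  have hn' : (n : ℚ) ≠ 0 := by positivity
  have key : ∑ b ∈ Finset.range n, (Polynomial.bernoulli k).eval ((n : ℚ)⁻¹ * (x + 1 + b)) =
      ∑ b ∈ Finset.range n, (Polynomial.bernoulli k).eval ((n : ℚ)⁻¹ * (x + b))
        + k * ((n : ℚ)⁻¹ * x) ^ (k - 1) := by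
    have h1 := Finset.sum_range_succ (fun b : ℕ => (Polynomial.bernoulli k).eval ((n : ℚ)⁻¹ * (x + b))) n
    have h2 := Finset.sum_range_succ' (fun b : ℕ => (Polynomial.bernoulli k).eval ((n : ℚ)⁻¹ * (x + b))) n
    rw [h1] at h2
    have h3 : (n : ℚ)⁻¹ * (x + n) = 1 + (n : ℚ)⁻¹ * x := by field_simp; ring
    rw [h3, Polynomial.bernoulli_eval_one_add] at h2
    have h4 : ∀ b : ℕ, x + 1 + (b : ℚ) = x + ((b + 1 : ℕ) : ℚ) := by intro b; push_cast; ring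
    simp only [h4]
    simp only [Nat.cast_zero, add_zero] at h2
    linarith
  simp only [bdG, eval_sub, eval_mul, eval_C, eval_finset_sum, eval_comp, eval_add, eval_X]
  rw [key, add_comm x 1, Polynomial.bernoulli_eval_one_add]
  rcases k with _ | k
  · simp
  · simp only [Nat.add_sub_cancel, mul_pow, inv_pow]
    field_simp
    ring

open Polynomial in
theorem bdG_deriv (n k : ℕ) (hn : 0 < n) :
    derivative (bdG n (k + 1)) = C ((k : ℚ) + 1) * bdG n k := by
  have hn' : (n : ℚ) ≠ 0 := by positivity
  have hC : (C ((n : ℚ) ^ (k+1)) * C ((n : ℚ)⁻¹) : ℚ[X]) = C ((n : ℚ) ^ k) := by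
    rw [← C_mul]; congr 1; field_simp; ring
  have hk : ((k : ℚ[X]) + 1) = C ((k : ℚ) + 1) := by simp
  simp only [bdG, derivative_sub, derivative_C_mul, derivative_sum, derivative_comp,
    Polynomial.derivative_bernoulli_add_one, derivative_add, derivative_X, derivative_C, add_zero,
    mul_one, mul_comp, hk, C_comp]
  rw [← Finset.mul_sum, ← Finset.mul_sum, ← hC]
  ring

open Polynomial in
theorem bdG_zero (n k : ℕ) (hn : 0 < n) : bdG n k = 0 := by
  have h := bdG_deriv n k hn
  rw [bd_const _ (bdG_per n (k+1) hn), derivative_C] at h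
  have h' : (C ((k : ℚ) + 1) : ℚ[X]) ≠ 0 := by
    rw [Ne, C_eq_zero]; positivity
  exact (mul_eq_zero.mp h.symm).resolve_left h'

theorem bd_mul (n k : ℕ) (hn : 0 < n) (x : ℚ) :
    (n : ℚ) ^ k * ∑ b ∈ Finset.range n, (Polynomial.bernoulli k).eval ((x + b) / n) =
      n * (Polynomial.bernoulli k).eval x := by
  have h := congrArg (Polynomial.eval x) (bdG_zero n k hn)
  simp only [bdG, Polynomial.eval_sub, Polynomial.eval_mul, Polynomial.eval_C,
    Polynomial.eval_finset_sum, Polynomial.eval_comp, Polynomial.eval_add, Polynomial.eval_X,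
    Polynomial.eval_zero] at h
  simp only [div_eq_inv_mul]
  linarith

theorem bd_shift (n : ℕ) (g : ℤ → ℚ) (hg : ∀ z, g (z + n) = g z) (q : ℤ) :
    ∑ b ∈ Finset.range n, g (q + b) = ∑ b ∈ Finset.range n, g b := by
  have step : ∀ q : ℤ, ∑ b ∈ Finset.range n, g (q + 1 + b) = ∑ b ∈ Finset.range n, g (q + b) := by
    intro q
    have h1 := Finset.sum_range_succ (fun b : ℕ => g (q + b)) n
    have h2 := Finset.sum_range_succ' (fun b : ℕ => g (q + b)) n
    rw [h1, hg] at h2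
    have h4 : ∀ b : ℕ, q + 1 + (b : ℤ) = q + ((b + 1 : ℕ) : ℤ) := by intro b; push_cast; ring
    simp only [h4]
    simp only [Nat.cast_zero, add_zero] at h2
    linarith
  induction q using Int.induction_on with
  | zero => simp
  | succ i ih => rw [step, ih]
  | pred i ih => rw [← ih, ← step, sub_add_cancel]

/-- **The `k`-th Bernoulli distribution.** For `k ≥ 1`, positive integers `j ∣ i` and
any integer `a`, `j^(k-1)·B_k({a/j}) = i^(k-1)·Σ_{b=0}^{i/j-1} B_k({(a+b·j)/i})`,
i.e. the functions `a/i ↦ i^(k-1)·B_k({a/i})` form a distribution on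
`lim_i (1/i)ℤ/ℤ`. -/
theorem bernoulli_distribution (k : ℕ) (hk : 1 ≤ k)
    (i j : ℕ) (hi : 0 < i) (hj : 0 < j) (hij : j ∣ i) (a : ℤ) :
    (j : ℚ) ^ (k - 1) * (Polynomial.bernoulli k).eval (Int.fract ((a : ℚ) / j)) =
      (i : ℚ) ^ (k - 1) *
        ∑ b ∈ Finset.range (i / j),
          (Polynomial.bernoulli k).eval (Int.fract (((a : ℚ) + b * j) / i)) := by
  obtain ⟨m, rfl⟩ := hij
  have hm : 0 < m := Nat.pos_of_mul_pos_left hi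
  have hm' : (m : ℚ) ≠ 0 := by positivity
  have hj' : (j : ℚ) ≠ 0 := by positivity
  rw [Nat.mul_div_cancel_left m hj]
  set x : ℚ := (a : ℚ) / j with hx
  have e1 : ∀ b : ℕ, ((a : ℚ) + b * j) / ((j * m : ℕ) : ℚ)
      = (Int.fract x + ((⌊x⌋ + (b : ℤ) : ℤ) : ℚ)) / m := by
    intro b
    have : Int.fract x + ((⌊x⌋ + (b : ℤ) : ℤ) : ℚ) = x + b := by
      have := Int.fract_add_floor x
      push_cast; linarith
    rw [this, hx]; push_cast; field_simp
  simp only [e1]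
  have hs := bd_shift m (fun z => (Polynomial.bernoulli k).eval
    (Int.fract ((Int.fract x + (z : ℚ)) / m))) (by
      intro z
      have : (Int.fract x + ((z + m : ℤ) : ℚ)) / m = (Int.fract x + (z : ℚ)) / m + 1 := by
        push_cast; field_simp; ring
      simp only [this, Int.fract_add_one]) ⌊x⌋
  rw [hs]
  have e2 : ∑ b ∈ Finset.range m, (Polynomial.bernoulli k).eval
      (Int.fract ((Int.fract x + ((b : ℤ) : ℚ)) / m)) =
      ∑ b ∈ Finset.range m, (Polynomial.bernoulli k).eval ((Int.fract x + b) / m) := by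
    apply Finset.sum_congr rfl
    intro b hb
    have hb' : (b : ℚ) + 1 ≤ m := by exact_mod_cast Finset.mem_range.mp hb
    have h0 := Int.fract_nonneg x
    have h1 := Int.fract_lt_one x
    rw [Int.cast_natCast, Int.fract_eq_self.mpr]
    constructor
    · positivity
    · rw [div_lt_one (by positivity)]; linarith
  rw [e2]
  have h := bd_mul m k hm (Int.fract x)
  obtain ⟨l, rfl⟩ : ∃ l, k = l + 1 := ⟨k - 1, by omega⟩
  rw [pow_succ', mul_assoc] at h
  have h' := mul_left_cancel₀ hm' h
  rw [Nat.add_sub_cancel, ← h']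
  push_cast
  ring
end

section
/- Let χ be a Dirichlet character of modulus N ≥ 1 with values in ℂ, and let n ≥ 1 be an integer. Then the analytically continued Dirichlet L-function of χ satisfies L(1−n, χ) = −B_{n,χ}/n, where B_{n,χ} is the generalized Bernoulli number of χ. -/
/-- The generalized Bernoulli number `B_{n,χ} = N^(n-1)·Σ_{a=1}^{N} χ(a)·B_n(a/N)` of a
Dirichlet character `χ` of modulus `N`, with values in a commutative `ℚ`-algebra. -/
noncomputable def generalizedBernoulli {R : Type*} [CommRing R] [Algebra ℚ R] {N : ℕ}
    (χ : DirichletCharacter R N) (n : ℕ) : R :=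
  (N : R) ^ (n - 1) *
    ∑ a ∈ Finset.range N,
      χ (((a + 1 : ℕ) : ZMod N)) *
        algebraMap ℚ R ((Polynomial.bernoulli n).eval (((a : ℚ) + 1) / N))

open Complex Filter Topology MeasureTheory Set in
lemma aux_slit {z : ℂ} (hz : ‖z‖ = 1) (hz1 : z ≠ 1) {t : ℝ} (ht : 0 ≤ t) :
    1 - z * (Real.exp (-t) : ℂ) ∈ slitPlane := by
  rw [mem_slitPlane_iff]
  by_contra! h
  obtain ⟨h1, h2⟩ := h
  have e0 := Real.exp_pos (-t)
  have e1 : Real.exp (-t) ≤ 1 := Real.exp_le_one_iff.mpr (by linarith)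
  generalize Real.exp (-t) = r at *
  have hre : z.re ≤ 1 := hz ▸ Complex.re_le_norm z
  simp [e0.ne'] at h1 h2
  have : z.re = 1 := by nlinarith
  exact hz1 (Complex.ext (by simpa using this) (by simpa using h2))

open Complex Filter Topology MeasureTheory Set in
lemma aux_mellin {z : ℂ} (hz : ‖z‖ = 1) (hz1 : z ≠ 1) :
    DifferentiableAt ℂ (mellin fun t : ℝ ↦
      z * (Real.exp (-t) : ℂ) / (1 - z * (Real.exp (-t) : ℂ))) 1 ∧
    mellin (fun t : ℝ ↦ z * (Real.exp (-t) : ℂ) / (1 - z * (Real.exp (-t) : ℂ))) 1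
      = -Complex.log (1 - z) := by
  set F : ℝ → ℂ := fun t ↦ z * (Real.exp (-t) : ℂ) / (1 - z * (Real.exp (-t) : ℂ)) with hF
  have hne (t : ℝ) (ht : 0 ≤ t) : 1 - z * (Real.exp (-t) : ℂ) ≠ 0 :=
    slitPlane_ne_zero (aux_slit hz hz1 ht)
  have hcont : ContinuousOn F (Ici 0) := by
    apply ContinuousOn.div
    · fun_prop
    · fun_prop
    · exact fun t ht ↦ hne t ht
  have hexp : Tendsto (fun t : ℝ ↦ 1 - z * (Real.exp (-t) : ℂ)) atTop (𝓝 1) := by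
    have h0 : Tendsto (fun t : ℝ ↦ ((Real.exp (-t) : ℝ) : ℂ)) atTop (𝓝 0) := by
      have := Real.tendsto_exp_neg_atTop_nhds_zero
      exact_mod_cast (Complex.continuous_ofReal.tendsto 0).comp this
    simpa using (h0.const_mul z).const_sub 1
  have htop : F =O[atTop] fun t => Real.exp (-(1:ℝ) * t) := by
    have h1 : (fun t : ℝ ↦ (1 - z * (Real.exp (-t) : ℂ))⁻¹) =O[atTop] fun _ ↦ (1:ℝ) :=
      (hexp.inv₀ one_ne_zero).isBigO_one ℝ
    have h2 : (fun t : ℝ ↦ z * (Real.exp (-t) : ℂ)) =O[atTop] fun t ↦ Real.exp (-(1:ℝ) * t) := by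
      apply Asymptotics.IsBigO.of_bound 1
      filter_upwards with t
      simp only [norm_mul, hz, Complex.norm_real, neg_mul, one_mul, le_refl]
    simpa [hF, div_eq_mul_inv] using h2.mul h1
  have hbot : F =O[𝓝[>] 0] fun t : ℝ ↦ t ^ (-(0:ℝ)) := by
    have : Tendsto F (𝓝[>] 0) (𝓝 (F 0)) :=
      (hcont 0 self_mem_Ici).mono_left (nhdsWithin_mono _ Ioi_subset_Ici_self)
    simpa using this.isBigO_one ℝ
  have hloc : LocallyIntegrableOn F (Ioi 0) :=
    (hcont.mono Ioi_subset_Ici_self).locallyIntegrableOn measurableSet_Ioi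
  refine ⟨mellin_differentiableAt_of_isBigO_rpow_exp one_pos hloc htop hbot (by simp), ?_⟩
  have hint : IntegrableOn F (Ioi 0) := by
    have := mellinConvergent_of_isBigO_rpow_exp one_pos hloc htop hbot (s := 1) (by simp)
    simpa [MellinConvergent] using this
  have := integral_Ioi_of_hasDerivAt_of_tendsto' (a := (0:ℝ)) (m := Complex.log 1)
    (f := fun t : ℝ ↦ Complex.log (1 - z * (Real.exp (-t) : ℂ))) (f' := F) ?_ hint ?_
  · simpa [mellin] using this
  · intro t ht
    have h1 : HasDerivAt (fun t : ℝ ↦ ((Real.exp (-t) : ℝ) : ℂ)) ((-Real.exp (-t) : ℝ) : ℂ) t := by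
      have := (Real.hasDerivAt_exp (-t)).comp t (hasDerivAt_neg t)
      simpa using this.ofReal_comp
    have h2 := ((h1.const_mul z).const_sub 1).clog_real (aux_slit hz hz1 ht)
    refine h2.congr_deriv ?_
    simp only [hF]
    push_cast
    ring
  · exact hexp.clog (by simp)

open Complex Filter Topology MeasureTheory Set HurwitzZeta in
lemma aux_expZeta {x : ℝ} (hz1 : cexp (2 * Real.pi * I * x) ≠ 1) :
    expZeta x 1 = -Complex.log (1 - cexp (2 * Real.pi * I * x)) := by
  set z := cexp (2 * Real.pi * I * x) with hzdef
  have hz : ‖z‖ = 1 := by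
    rw [hzdef, Complex.norm_exp]; simp
  have hx0 : (x : UnitAddCircle) ≠ 0 := by
    intro h
    obtain ⟨m, hm⟩ := (AddCircle.coe_eq_zero_iff (1:ℝ)).mp h
    apply hz1
    rw [hzdef, ← hm, Complex.exp_eq_one_iff]
    exact ⟨m, by push_cast; simp; ring⟩
  obtain ⟨hd, hv⟩ := aux_mellin hz hz1
  set F : ℝ → ℂ := fun t ↦ z * (Real.exp (-t) : ℂ) / (1 - z * (Real.exp (-t) : ℂ)) with hF
  have key (s : ℝ) (hs : 1 < s) : mellin F s = Complex.Gamma s * expZeta x s := by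
    have h1 := hasSum_expZeta_of_one_lt_re x (s := s) (by simpa using hs)
    rw [← hasSum_nat_add_iff' 1] at h1
    have hs0 : (s : ℂ) ≠ 0 := by exact_mod_cast (by linarith : s ≠ 0)
    have h2 := hasSum_mellin (a := fun n : ℕ ↦ z ^ (n + 1)) (p := fun n ↦ (n : ℝ) + 1) (F := F)
      (s := s) (fun n ↦ Or.inr (by positivity)) (by simp; linarith) ?_ ?_
    · refine h2.unique ?_
      have h3 := h1.mul_left (Complex.Gamma s)
      simp only [Finset.range_one, Finset.sum_singleton, Nat.cast_zero,
        Complex.zero_cpow hs0, div_zero, sub_zero] at h3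
      refine Eq.subst (motive := fun f : ℕ → ℂ ↦ HasSum f _) (funext fun n ↦ ?_) h3
      symm
      rw [hzdef, ← Complex.exp_nat_mul, mul_div_assoc]
      push_cast
      ring_nf
    · intro t ht
      have hlt : ‖z * (Real.exp (-t) : ℂ)‖ < 1 := by
        rw [norm_mul, hz, one_mul, Complex.norm_real, Real.norm_of_nonneg (Real.exp_pos _).le]
        exact Real.exp_lt_one_iff.mpr (by simpa using ht)
      have := (hasSum_geometric_of_norm_lt_one hlt).mul_left (z * (Real.exp (-t) : ℂ))
      rw [hF]
      simp only [div_eq_mul_inv]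
      refine Eq.subst (motive := fun f : ℕ → ℂ ↦ HasSum f _) (funext fun n ↦ ?_) this
      symm
      rw [← pow_succ', mul_pow, ← Complex.ofReal_pow, ← Real.exp_nat_mul]
      push_cast
      ring_nf
    · simp only [norm_pow, hz, one_pow, Complex.ofReal_re]
      have := (summable_nat_add_iff 1).mpr (Real.summable_one_div_nat_rpow.mpr hs)
      simpa using this
  have hlim : Tendsto (fun s : ℝ ↦ (s : ℂ)) (𝓝[>] 1) (𝓝 1) :=
    (Complex.continuous_ofReal.tendsto' 1 1 (by simp)).mono_left nhdsWithin_le_nhds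
  have l1 : Tendsto (fun s : ℝ ↦ mellin F s) (𝓝[>] 1) (𝓝 (mellin F 1)) :=
    hd.continuousAt.tendsto.comp hlim
  have l2 : Tendsto (fun s : ℝ ↦ Complex.Gamma s * expZeta x s) (𝓝[>] 1)
      (𝓝 (Complex.Gamma 1 * expZeta x 1)) := by
    refine Tendsto.mul ?_ ?_
    · exact (Complex.differentiableAt_Gamma 1 (fun m h ↦ by
        have := congrArg Complex.re h
        simp at this
        have h2 : (0:ℝ) ≤ m := m.cast_nonneg
        linarith)).continuousAt.tendsto.comp hlim
    · exact (differentiableAt_expZeta _ _ (Or.inr hx0)).continuousAt.tendsto.comp hlim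
  have := tendsto_nhds_unique (l1.congr' (by
    filter_upwards [self_mem_nhdsWithin] with s hs using key s hs)) l2
  rw [Complex.Gamma_one, one_mul, hv] at this
  exact this.symm

open Complex in
lemma aux_log {x : ℝ} (h0 : 0 < x) (h1 : x < 1) :
    cexp (2 * Real.pi * I * x) ≠ 1 ∧ Complex.log (1 - cexp (2 * Real.pi * I * x)) =
      (Real.log (2 * Real.sin (Real.pi * x)) : ℂ) + (Real.pi * x - Real.pi / 2) * I := by
  have hs : 0 < 2 * Real.sin (Real.pi * x) := by
    have := Real.sin_pos_of_pos_of_lt_pi (x := Real.pi * x) (by positivity)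
      (by nlinarith [Real.pi_pos])
    linarith
  have hf : 1 - cexp (2 * Real.pi * I * x) = ((2 * Real.sin (Real.pi * x) : ℝ) : ℂ) *
      cexp ((Real.pi * x - Real.pi / 2) * I) := by
    rw [sub_mul, Complex.exp_sub, Complex.exp_pi_div_two_mul_I]
    push_cast
    rw [Complex.sin]
    have e1 : cexp (2 * Real.pi * I * x) = cexp (Real.pi * x * I) * cexp (Real.pi * x * I) := by
      rw [← Complex.exp_add]; ring_nf
    have e2 : cexp (-(Real.pi * x) * I) * cexp (Real.pi * x * I) = 1 := by
      rw [← Complex.exp_add]; simp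
    rw [e1, ← e2]
    field_simp
    try ring
  refine ⟨?_, ?_⟩
  · intro h
    rw [h, sub_self] at hf
    exact mul_ne_zero (by exact_mod_cast hs.ne') (Complex.exp_ne_zero _) hf.symm
  · rw [hf, Complex.log_ofReal_mul hs (Complex.exp_ne_zero _), Complex.log_exp]
    · simp
      nlinarith [Real.pi_pos]
    · simp
      nlinarith [Real.pi_pos]

open Complex HurwitzZeta in
lemma aux_hurwitz_zero {x : ℝ} (h0 : 0 < x) (h1 : x ≤ 1) :
    hurwitzZeta x 0 = 1 / 2 - x := by
  rcases h1.eq_or_lt with rfl | h1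
  · have : ((1 : ℝ) : UnitAddCircle) = 0 := AddCircle.coe_period 1
    rw [this, hurwitzZeta_zero, riemannZeta_zero]
    norm_num
  have hx0 : (x : UnitAddCircle) ≠ 0 := by
    intro h
    obtain ⟨m, hm⟩ := (AddCircle.coe_eq_zero_iff (1:ℝ)).mp h
    simp at hm
    rw [← hm] at h0 h1
    norm_cast at h0 h1
    omega
  obtain ⟨a1, a2⟩ := aux_log h0 h1
  obtain ⟨b1, b2⟩ := aux_log (x := 1 - x) (by linarith) (by linarith)
  have hneg : -(x : UnitAddCircle) = ((1 - x : ℝ) : UnitAddCircle) := by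
    rw [AddCircle.coe_sub, AddCircle.coe_period, zero_sub]
  have hsin : sinZeta x 1 = Real.pi * (1 / 2 - x) := by
    rw [sinZeta_eq, hneg, aux_expZeta a1, aux_expZeta b1, a2, b2]
    have : Real.sin (Real.pi * (1 - x)) = Real.sin (Real.pi * x) := by
      rw [mul_sub, mul_one, Real.sin_pi_sub]
    rw [this]
    push_cast
    field_simp
    ring
  have hodd := hurwitzZetaOdd_one_sub (x : UnitAddCircle) (s := 1) (fun m h ↦ by
        have := congrArg Complex.re h
        simp at this
        have h2 : (0:ℝ) ≤ m := m.cast_nonneg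
        linarith)
  rw [sub_self] at hodd
  rw [hurwitzZeta, hurwitzZetaEven_apply_zero, if_neg hx0, hodd, hsin]
  have : (Real.pi : ℂ) ≠ 0 := by exact_mod_cast Real.pi_ne_zero
  simp [Complex.cpow_neg_one]
  field_simp

open HurwitzZeta in
lemma aux_hurwitz (n : ℕ) (hn : 1 ≤ n) (q : ℚ) (h0 : 0 < q) (h1 : q ≤ 1) :
    hurwitzZeta ((q : ℝ) : UnitAddCircle) (1 - n) =
      - algebraMap ℚ ℂ ((Polynomial.bernoulli n).eval q) / n := by
  obtain ⟨k, rfl⟩ := Nat.exists_eq_add_of_le' hn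
  have h0' : (0:ℝ) < q := by exact_mod_cast h0
  have h1' : (q:ℝ) ≤ 1 := by exact_mod_cast h1
  have e : (1 - ((k + 1 : ℕ) : ℂ)) = -k := by push_cast; ring
  rw [e]
  rcases eq_or_ne k 0 with rfl | hk
  · rw [Nat.cast_zero, neg_zero, aux_hurwitz_zero h0' h1']
    simp [Polynomial.bernoulli_one]
  · rw [hurwitzZeta_neg_nat hk ⟨h0'.le, h1'⟩]
    have : (((q : ℝ)) : ℂ) = algebraMap ℚ ℂ q := by simp
    rw [this, Polynomial.eval_map_apply]
    push_cast
    ring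

/-- The analytically continued Dirichlet `L`-function of a Dirichlet character `χ` of
modulus `N ≥ 1` satisfies `L(1-n, χ) = -B_{n,χ}/n` for every integer `n ≥ 1`. -/
theorem LFunction_one_sub_eq_neg_generalizedBernoulli_div
    {N : ℕ} [NeZero N] (χ : DirichletCharacter ℂ N) (n : ℕ) (hn : 1 ≤ n) :
    DirichletCharacter.LFunction χ (1 - n) = -(generalizedBernoulli χ n) / n := by
  have hN : 0 < N := NeZero.pos N
  have hsum (f : ZMod N → ℂ) : ∑ j, f j = ∑ a ∈ Finset.range N, f ((a + 1 : ℕ) : ZMod N) := by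
    rw [← Equiv.sum_comp (Equiv.addRight (1 : ZMod N)) f]
    symm
    refine Finset.sum_bij' (fun a _ ↦ (a : ZMod N)) (fun j _ ↦ j.val) ?_ ?_ ?_ ?_ ?_
    · simp
    · intro j _; simpa using ZMod.val_lt j
    · intro a ha; exact ZMod.val_cast_of_lt (Finset.mem_range.mp ha)
    · intro j _; simp
    · intro a _; simp
  rw [DirichletCharacter.LFunction, ZMod.LFunction, hsum, generalizedBernoulli]
  have hp : (N : ℂ) ^ (-(1 - (n : ℂ))) = (N : ℂ) ^ (n - 1) := by
    rw [← Complex.cpow_natCast]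
    congr 1
    push_cast [hn]
    ring
  rw [hp, ← mul_neg, mul_div_assoc, ← Finset.sum_neg_distrib, Finset.sum_div]
  congr 1
  refine Finset.sum_congr rfl fun a ha ↦ ?_
  have ha' : a + 1 ≤ N := Finset.mem_range.mp ha
  have hNq : (0 : ℚ) < N := by exact_mod_cast hN
  have := aux_hurwitz n hn (((a : ℚ) + 1) / N) (by positivity)
    (by rw [div_le_one hNq]; exact_mod_cast ha')
  rw [ZMod.toAddCircle_natCast]
  push_cast at this ⊢
  rw [this]
  ring
end

section
/- (Serre, Théorème 1) Let p be an odd prime and m ≥ 1 an integer. Let f be a modular form of weight k and level 1 and g a modular form of weight k' and level 1, both with rational q-expansions, with coefficients (a_n)_{n≥0} and (b_n)_{n≥0} viewed in ℚ_p. Suppose there is an integer v such that ‖a_n‖_p ≤ p^{-v} for all n and ‖a_{n₀}‖_p = p^{-v} for some n₀ (so v = v_p(f) and f ≠ 0), and suppose ‖a_n − b_n‖_p ≤ p^{-(v+m)} for all n (i.e., v_p(f − g) ≥ v_p(f) + m). Then k ≡ k' (mod (p−1)·p^{m−1}). -/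
/-- A level-1 modular form `f` of weight `k` has rational `q`-expansion with
coefficients `a : ℕ → ℚ` if `f(τ) = Σ_{n≥0} a_n·qⁿ` with `q = exp(2πiτ)` for all
`τ` in the upper half plane. -/
def HasRationalQExpansion {k : ℤ} (f : ModularForm (CongruenceSubgroup.Gamma 1) k)
    (a : ℕ → ℚ) : Prop :=
  ∀ τ : UpperHalfPlane,
    HasSum (fun n : ℕ =>
      (a n : ℂ) * Complex.exp (2 * Real.pi * Complex.I * n * (τ : ℂ))) (f τ)

section Helpers

open UpperHalfPlane ModularForm MatrixGroups Matrix

noncomputable def heckeUp (l : ℕ) (hl : l ≠ 0) : GL (Fin 2) ℝ :=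
  Matrix.GeneralLinearGroup.mkOfDetNeZero !![(l : ℝ), 0; 0, 1] (by simp [hl])

noncomputable def heckeDn (l : ℕ) (hl : l ≠ 0) (b : ℕ) : GL (Fin 2) ℝ :=
  Matrix.GeneralLinearGroup.mkOfDetNeZero !![1, (b : ℝ); 0, (l : ℝ)] (by simp [hl])

lemma heckeUp_val (l : ℕ) (hl : l ≠ 0) :
    (heckeUp l hl : Matrix (Fin 2) (Fin 2) ℝ) = !![(l : ℝ), 0; 0, 1] := rfl
lemma heckeDn_val (l : ℕ) (hl : l ≠ 0) (b : ℕ) :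
    (heckeDn l hl b : Matrix (Fin 2) (Fin 2) ℝ) = !![1, (b : ℝ); 0, (l : ℝ)] := rfl

lemma heckeUp_det (l : ℕ) (hl : l ≠ 0) : (heckeUp l hl).det.val = l := by
  simp [heckeUp_val]
lemma heckeDn_det (l : ℕ) (hl : l ≠ 0) (b : ℕ) : (heckeDn l hl b).det.val = l := by
  simp [heckeDn_val]

lemma hecke_SL_val (γ : SL(2, ℤ)) (i j : Fin 2) :
    ((γ : GL (Fin 2) ℝ) : Matrix (Fin 2) (Fin 2) ℝ) i j = ((γ.1 i j : ℤ) : ℝ) := rfl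

lemma hecke_slash_dn_S (f : ℍ → ℂ) (k : ℤ) (hf : ∀ γ : SL(2, ℤ), f ∣[k] γ = f)
    (l : ℕ) (hl : l ≠ 0) (b b' : ℕ) (hb : (l : ℤ) ∣ b * b' + 1) :
    (f ∣[k] heckeDn l hl b) ∣[k] ModularGroup.S = f ∣[k] heckeDn l hl b' := by
  obtain ⟨c, hc⟩ := hb
  let γ : SL(2, ℤ) := ⟨!![(b : ℤ), -c; (l : ℤ), -b'], by
    simp [Matrix.det_fin_two]; linarith⟩
  have h : heckeDn l hl b * (ModularGroup.S : GL (Fin 2) ℝ) = (γ : GL (Fin 2) ℝ) * heckeDn l hl b' := by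
    have hc' : (b : ℝ) * b' + 1 = l * c := by exact_mod_cast hc
    ext i j
    fin_cases i <;> fin_cases j <;>
      simp only [Units.val_mul, Matrix.mul_apply, Fin.sum_univ_two, hecke_SL_val, heckeDn_val] <;>
      simp [ModularGroup.S, γ]
    · linarith
    · ring
  rw [ModularForm.SL_slash, ← SlashAction.slash_mul, h, SlashAction.slash_mul, ← ModularForm.SL_slash, hf]

lemma hecke_slash_dn0_S (f : ℍ → ℂ) (k : ℤ) (hf : ∀ γ : SL(2, ℤ), f ∣[k] γ = f)
    (l : ℕ) (hl : l ≠ 0) :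
    (f ∣[k] heckeDn l hl 0) ∣[k] ModularGroup.S = f ∣[k] heckeUp l hl := by
  have h : heckeDn l hl 0 * (ModularGroup.S : GL (Fin 2) ℝ)
      = (ModularGroup.S : GL (Fin 2) ℝ) * heckeUp l hl := by
    ext i j
    fin_cases i <;> fin_cases j <;>
      simp only [Units.val_mul, Matrix.mul_apply, Fin.sum_univ_two, hecke_SL_val, heckeDn_val,
        heckeUp_val] <;>
      simp [ModularGroup.S]
  rw [ModularForm.SL_slash, ← SlashAction.slash_mul, h, SlashAction.slash_mul, ← ModularForm.SL_slash, hf]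

lemma hecke_slash_up_S (f : ℍ → ℂ) (k : ℤ) (hf : ∀ γ : SL(2, ℤ), f ∣[k] γ = f)
    (l : ℕ) (hl : l ≠ 0) :
    (f ∣[k] heckeUp l hl) ∣[k] ModularGroup.S = f ∣[k] heckeDn l hl 0 := by
  have h : heckeUp l hl * (ModularGroup.S : GL (Fin 2) ℝ)
      = (ModularGroup.S : GL (Fin 2) ℝ) * heckeDn l hl 0 := by
    ext i j
    fin_cases i <;> fin_cases j <;>
      simp only [Units.val_mul, Matrix.mul_apply, Fin.sum_univ_two, hecke_SL_val, heckeDn_val,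
        heckeUp_val] <;>
      simp [ModularGroup.S]
  rw [ModularForm.SL_slash, ← SlashAction.slash_mul, h, SlashAction.slash_mul, ← ModularForm.SL_slash, hf]

noncomputable def heckeFun (f : ℍ → ℂ) (k : ℤ) (l : ℕ) (hl : l ≠ 0) : ℍ → ℂ :=
  f ∣[k] heckeUp l hl + ∑ b ∈ Finset.range l, f ∣[k] heckeDn l hl b

lemma heckeFun_S (f : ℍ → ℂ) (k : ℤ) (hf : ∀ γ : SL(2, ℤ), f ∣[k] γ = f)
    (l : ℕ) (hp : l.Prime) :
    (heckeFun f k l hp.ne_zero) ∣[k] ModularGroup.S = heckeFun f k l hp.ne_zero := by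
  have hl := hp.ne_zero
  have : Fact l.Prime := ⟨hp⟩
  have h0 : 0 ∈ Finset.range l := by simp [hp.pos]
  have hsum : ∀ F : ℕ → (ℍ → ℂ), ∑ b ∈ Finset.range l, F b
      = F 0 + ∑ b ∈ (Finset.univ : Finset (ZMod l)).erase 0, F b.val := by
    intro F
    rw [show F 0 = F (ZMod.val (0 : ZMod l)) by simp,
      Finset.add_sum_erase _ (fun b : ZMod l => F b.val) (Finset.mem_univ 0)]
    refine Finset.sum_nbij' (fun b => (b : ZMod l)) (fun b => b.val) ?_ ?_ ?_ ?_ ?_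
    · simp
    · intro a _; simpa using ZMod.val_lt a
    · intro a ha; exact ZMod.val_cast_of_lt (by simpa using ha)
    · intro a _; simp
    · intro a ha
      rw [ZMod.val_cast_of_lt (by simpa using ha)]
  unfold heckeFun
  rw [SlashAction.add_slash, SlashAction.sum_slash, hsum, hsum, hecke_slash_up_S f k hf,
    hecke_slash_dn0_S f k hf, add_left_comm]
  congr 2
  refine Finset.sum_nbij' (fun b => -b⁻¹) (fun b => -b⁻¹) ?_ ?_ ?_ ?_ ?_
  · simp
  · simp
  · intro a _; simp [inv_neg]
  · intro a _; simp [inv_neg]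
  · intro a ha
    apply hecke_slash_dn_S f k hf
    have : ((((a.val : ℕ) : ℤ) * (((-a⁻¹ : ZMod l).val : ℕ) : ℤ) + 1 : ℤ) : ZMod l) = 0 := by
      push_cast
      have ha' : a ≠ 0 := by simpa using ha
      rw [ZMod.natCast_zmod_val, ZMod.natCast_zmod_val]
      field_simp; ring
    exact (ZMod.intCast_zmod_eq_zero_iff_dvd _ _).1 this

lemma hecke_up_apply (f : ℍ → ℂ) (k : ℤ) (l : ℕ) (hl : l ≠ 0) (τ : ℍ) :
    (f ∣[k] heckeUp l hl) τ = (l : ℂ) ^ (k - 1) * f (heckeUp l hl • τ) := by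
  have hpos : (0 : ℝ) < (heckeUp l hl).det.val := by
    rw [heckeUp_det]; exact_mod_cast Nat.pos_of_ne_zero hl
  rw [ModularForm.slash_apply, heckeUp_det]
  simp only [UpperHalfPlane.σ, hpos, if_true, UpperHalfPlane.denom, heckeUp_val]
  simp [mul_comm]

lemma hecke_dn_apply (f : ℍ → ℂ) (k : ℤ) (l : ℕ) (hl : l ≠ 0) (b : ℕ) (τ : ℍ) :
    (f ∣[k] heckeDn l hl b) τ = (l : ℂ)⁻¹ * f (heckeDn l hl b • τ) := by
  have hpos : (0 : ℝ) < (heckeDn l hl b).det.val := by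
    rw [heckeDn_det]; exact_mod_cast Nat.pos_of_ne_zero hl
  have hl' : (l : ℂ) ≠ 0 := by exact_mod_cast hl
  rw [ModularForm.slash_apply, heckeDn_det]
  simp only [UpperHalfPlane.σ, hpos, if_true, UpperHalfPlane.denom, heckeDn_val]
  simp [mul_comm]
  rw [zpow_sub_one₀ hl']
  field_simp

lemma hecke_up_coe (l : ℕ) (hl : l ≠ 0) (τ : ℍ) :
    ((heckeUp l hl • τ : ℍ) : ℂ) = l * τ := by
  have hpos : (0 : ℝ) < (heckeUp l hl).det.val := by
    rw [heckeUp_det]; exact_mod_cast Nat.pos_of_ne_zero hl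
  rw [UpperHalfPlane.coe_smul_of_det_pos hpos]
  simp only [UpperHalfPlane.num, UpperHalfPlane.denom, heckeUp_val]
  simp

lemma hecke_dn_coe (l : ℕ) (hl : l ≠ 0) (b : ℕ) (τ : ℍ) :
    ((heckeDn l hl b • τ : ℍ) : ℂ) = (τ + b) / l := by
  have hpos : (0 : ℝ) < (heckeDn l hl b).det.val := by
    rw [heckeDn_det]; exact_mod_cast Nat.pos_of_ne_zero hl
  rw [UpperHalfPlane.coe_smul_of_det_pos hpos]
  simp only [UpperHalfPlane.num, UpperHalfPlane.denom, heckeDn_val]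
  simp

lemma hecke_geom (l : ℕ) (hl : l ≠ 0) (n : ℕ) :
    ∑ b ∈ Finset.range l, Complex.exp (2 * Real.pi * Complex.I * n * (b / l))
      = if l ∣ n then (l : ℂ) else 0 := by
  have hprim := Complex.isPrimitiveRoot_exp l hl
  set ζ := Complex.exp (2 * Real.pi * Complex.I / l) with hζ
  have h : ∀ b : ℕ, Complex.exp (2 * Real.pi * Complex.I * n * (b / l)) = (ζ ^ n) ^ b := by
    intro b
    rw [hζ, ← Complex.exp_nat_mul, ← Complex.exp_nat_mul]
    congr 1; ring
  simp_rw [h]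
  split_ifs with hd
  · rw [(hprim.pow_eq_one_iff_dvd n).2 hd]; simp
  · have h1 : ζ ^ n ≠ 1 := fun h => hd ((hprim.pow_eq_one_iff_dvd n).1 h)
    have h2 := mul_neg_geom_sum (ζ ^ n) l
    rw [← pow_mul, mul_comm n l, pow_mul, hprim.pow_eq_one, one_pow, sub_self] at h2
    exact (mul_eq_zero.1 h2).resolve_left (sub_ne_zero.2 (Ne.symm h1))

lemma heckeFun_hasSum (f : ℍ → ℂ) (k : ℤ) (l : ℕ) (hl : l ≠ 0) (a : ℕ → ℂ)
    (ha : ∀ τ : ℍ, HasSum (fun n : ℕ => a n * Complex.exp (2 * Real.pi * Complex.I * n * (τ : ℂ))) (f τ))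
    (τ : ℍ) :
    HasSum (fun n : ℕ => (a (l * n) + (l : ℂ) ^ (k - 1) * (if l ∣ n then a (n / l) else 0)) *
      Complex.exp (2 * Real.pi * Complex.I * n * (τ : ℂ))) (heckeFun f k l hl τ) := by
  have hl' : (l : ℂ) ≠ 0 := by exact_mod_cast hl
  have hinj : Function.Injective (fun n : ℕ => l * n) := fun x y h =>
    Nat.eq_of_mul_eq_mul_left (Nat.pos_of_ne_zero hl) h
  have hup : HasSum (fun n : ℕ => (l : ℂ) ^ (k - 1) * (if l ∣ n then a (n / l) else 0) *
      Complex.exp (2 * Real.pi * Complex.I * n * (τ : ℂ))) ((f ∣[k] heckeUp l hl) τ) := by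
    rw [hecke_up_apply]
    refine (hinj.hasSum_iff ?_).1 ?_
    · intro n hn
      have : ¬ l ∣ n := fun ⟨c, hc⟩ => hn ⟨c, hc.symm⟩
      simp [this]
    · refine HasSum.congr_fun ((ha (heckeUp l hl • τ)).mul_left ((l : ℂ) ^ (k - 1))) fun n => ?_
      rw [hecke_up_coe]
      simp only [Function.comp, dvd_mul_right, if_true, Nat.mul_div_cancel_left n (Nat.pos_of_ne_zero hl)]
      rw [mul_assoc]
      congr 3
      push_cast; ring
  have hdn : HasSum (fun n : ℕ => a (l * n) *
      Complex.exp (2 * Real.pi * Complex.I * n * (τ : ℂ)))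
      ((∑ b ∈ Finset.range l, f ∣[k] heckeDn l hl b) τ) := by
    rw [Finset.sum_apply]
    have h1 : HasSum (fun n : ℕ => ∑ b ∈ Finset.range l, (l : ℂ)⁻¹ * (a n *
        Complex.exp (2 * Real.pi * Complex.I * n * ((heckeDn l hl b • τ : ℍ) : ℂ))))
        (∑ b ∈ Finset.range l, (f ∣[k] heckeDn l hl b) τ) := by
      apply hasSum_sum
      intro b _
      rw [hecke_dn_apply]
      exact (ha _).mul_left _
    have h2 : ∀ n : ℕ, ∑ b ∈ Finset.range l, (l : ℂ)⁻¹ * (a n *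
        Complex.exp (2 * Real.pi * Complex.I * n * ((heckeDn l hl b • τ : ℍ) : ℂ)))
        = if l ∣ n then a n * Complex.exp (2 * Real.pi * Complex.I * n * (τ / l)) else 0 := by
      intro n
      have h3 : ∀ b : ℕ, (l : ℂ)⁻¹ * (a n *
        Complex.exp (2 * Real.pi * Complex.I * n * ((heckeDn l hl b • τ : ℍ) : ℂ)))
        = (l : ℂ)⁻¹ * (a n * Complex.exp (2 * Real.pi * Complex.I * n * (τ / l))) *
          Complex.exp (2 * Real.pi * Complex.I * n * (b / l)) := by
        intro b
        rw [hecke_dn_coe, add_div, mul_add, Complex.exp_add]; ring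
      simp_rw [h3]
      rw [← Finset.mul_sum, hecke_geom l hl]
      split_ifs
      · field_simp
      · simp
    simp_rw [h2] at h1
    rw [← hinj.hasSum_iff] at h1
    · convert h1 using 1
      ext n
      simp only [Function.comp, dvd_mul_right, if_true]
      congr 2
      push_cast; field_simp
    · intro n hn
      have : ¬ l ∣ n := fun ⟨c, hc⟩ => hn ⟨c, hc.symm⟩
      simp [this]
  have := hdn.add hup
  unfold heckeFun
  rw [add_comm, Pi.add_apply]
  convert this using 1
  ext n; ring

lemma qpar (τ : ℍ) (n : ℕ) : Function.Periodic.qParam 1 (τ : ℂ) ^ n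
    = Complex.exp (2 * Real.pi * Complex.I * n * (τ : ℂ)) := by
  rw [Function.Periodic.qParam, ← Complex.exp_nat_mul]
  congr 1; push_cast; ring

lemma hasSum_q {k : ℤ} (f : ModularForm 𝒮ℒ k) (τ : ℍ) :
    HasSum (fun n : ℕ => (qExpansion 1 f).coeff n *
      Complex.exp (2 * Real.pi * Complex.I * n * (τ : ℂ))) (f τ) := by
  simpa only [qpar] using ModularForm.hasSum_qExpansion f one_pos one_mem_strictPeriods_SL τ

lemma q_unique {k : ℤ} (f : ModularForm 𝒮ℒ k) (c : ℕ → ℂ) (h : ∀ τ : ℍ, HasSum (fun n : ℕ => c n *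
      Complex.exp (2 * Real.pi * Complex.I * n * (τ : ℂ))) (f τ)) (n : ℕ) :
    (qExpansion 1 f).coeff n = c n := by
  refine (ModularFormClass.qExpansion_coeff_unique (f := f) one_pos one_mem_strictPeriods_SL ?_ n).symm
  intro τ
  simpa only [qpar, smul_eq_mul] using h τ

lemma heckeFun_T (F : ℍ → ℂ) (k : ℤ) (c : ℕ → ℂ) (h : ∀ τ : ℍ, HasSum (fun n : ℕ => c n *
      Complex.exp (2 * Real.pi * Complex.I * n * (τ : ℂ))) (F τ)) :
    F ∣[k] ModularGroup.T = F := by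
  ext τ
  rw [ModularForm.SL_slash_apply]
  have : F (ModularGroup.T • τ) = F τ := by
    refine (h _).unique ?_
    convert h τ using 1
    ext n
    rw [UpperHalfPlane.modular_T_smul, UpperHalfPlane.coe_vadd]
    congr 1
    rw [mul_add, Complex.exp_add]
    have := Complex.exp_nat_mul_two_pi_mul_I n
    push_cast
    rw [show 2 * (Real.pi : ℂ) * Complex.I * n * 1 = n * (2 * Real.pi * Complex.I) by ring, this, one_mul]
  rw [this]
  simp only [UpperHalfPlane.denom, hecke_SL_val]
  simp [ModularGroup.T]

theorem exists_hecke {k : ℤ} (f : ModularForm 𝒮ℒ k) (l : ℕ) (hp : l.Prime) :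
    ∃ g : ModularForm 𝒮ℒ k, ∀ n, (qExpansion 1 g).coeff n = (qExpansion 1 f).coeff (l * n) +
      (l : ℂ) ^ (k - 1) * (if l ∣ n then (qExpansion 1 f).coeff (n / l) else 0) := by
  have hf : ∀ γ : SL(2, ℤ), (f : ℍ → ℂ) ∣[k] γ = f := fun γ => f.slash_action_eq' _ ⟨γ, rfl⟩
  have hs := heckeFun_hasSum f k l hp.ne_zero _ (hasSum_q f)
  have hinv := SlashInvariantForm.slash_action_generators_SL2Z (heckeFun_S f k hf l hp) (heckeFun_T _ k _ hs)
  let g : ModularForm 𝒮ℒ k :=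
    { toFun := heckeFun f k l hp.ne_zero
      slash_action_eq' := by
        rintro A ⟨A, rfl⟩
        exact hinv A
      holo' := by
        have h1 := ModularFormClass.holo f
        unfold heckeFun
        apply MDifferentiable.add
        · exact h1.slash k _
        · apply MDifferentiable.sum
          intro i _
          exact h1.slash k _
      bdd_at_cusps' := by
        intro c hc
        rw [Subgroup.IsArithmetic.isCusp_iff_isCusp_SL2Z] at hc
        rw [OnePoint.isBoundedAt_iff_forall_SL2Z hc]
        intro γ _
        rw [hinv]
        refine isBoundedAtImInfty_of_hasSum_qExpansion one_pos (c := fun n => (qExpansion 1 f).coeff (l * n) +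
      (l : ℂ) ^ (k - 1) * (if l ∣ n then (qExpansion 1 f).coeff (n / l) else 0)) ?_
        intro τ
        simpa only [qpar, smul_eq_mul] using hs τ }
  exact ⟨g, q_unique g _ hs⟩

noncomputable def coefLin (k : ℤ) (n : ℕ) : ModularForm 𝒮ℒ k →ₗ[ℂ] ℂ where
  toFun f := (qExpansion 1 f).coeff n
  map_add' f g := by
    have := ModularForm.qExpansion_add one_pos one_mem_strictPeriods_SL f g
    simp only [FunLike.coe_add]
    rw [this, map_add]
  map_smul' c f := by
    have := ModularForm.qExpansion_smul one_pos one_mem_strictPeriods_SL c f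
    simp only [FunLike.coe_smul]
    rw [this]; simp

lemma padic_det_ne_zero {p : ℕ} [Fact p.Prime] {N : ℕ} (B : Matrix (Fin N) (Fin N) ℚ_[p]) (r : ℝ)
    (hr : 0 < r)
    (hoff : ∀ i j, i ≠ j → ‖B i j‖ ≤ r) (hdiag : ∀ i, r < ‖B i i‖) : B.det ≠ 0 := by
  intro h0
  obtain ⟨x, hx, hBx⟩ := Matrix.exists_mulVec_eq_zero_iff.2 h0
  obtain ⟨i₁, hi₁⟩ : ∃ i, x i ≠ 0 := by
    by_contra! h; exact hx (funext h)
  obtain ⟨i, -, hi⟩ := Finset.exists_max_image Finset.univ (fun i => ‖x i‖) ⟨i₁, Finset.mem_univ _⟩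
  have hxi : 0 < ‖x i‖ := (norm_pos_iff.2 hi₁).trans_le (hi i₁ (Finset.mem_univ _))
  have h1 : ∑ j, B i j * x j = 0 := congrFun hBx i
  rw [← Finset.add_sum_erase _ _ (Finset.mem_univ i)] at h1
  have h2 : ‖∑ j ∈ Finset.univ.erase i, B i j * x j‖ ≤ r * ‖x i‖ := by
    apply IsUltrametricDist.norm_sum_le_of_forall_le_of_nonneg (by positivity)
    intro j hj
    rw [norm_mul]
    exact mul_le_mul (hoff i j (Finset.ne_of_mem_erase hj).symm) (hi j (Finset.mem_univ _))
      (norm_nonneg _) hr.le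
  rw [eq_neg_of_add_eq_zero_right h1, norm_neg, norm_mul] at h2
  exact absurd (le_of_mul_le_mul_right h2 hxi) (not_lt.2 (hdiag i).le |> fun _ => not_le.2 (hdiag i))

lemma gauss_conv {p : ℕ} [Fact p.Prime] (a d : ℕ → ℚ_[p]) (A B : ℝ) (hA : 0 < A) (hB : 0 < B)
    (ha : ∀ n, ‖a n‖ ≤ A) (ha0 : ∃ n, ‖a n‖ = A) (hd : ∀ n, ‖d n‖ ≤ B) (hd0 : ∃ n, ‖d n‖ = B)
    (hz : d 0 = 0) :
    ∃ s, 1 ≤ s ∧ ‖∑ ij ∈ Finset.HasAntidiagonal.antidiagonal s, a ij.1 * d ij.2‖ = A * B := by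
  classical
  set u := Nat.find ha0 with hu
  set w := Nat.find hd0 with hw
  have hu1 : ‖a u‖ = A := Nat.find_spec ha0
  have hw1 : ‖d w‖ = B := Nat.find_spec hd0
  have hw0 : w ≠ 0 := by
    intro h; rw [h, hz, norm_zero] at hw1; exact hB.ne hw1
  refine ⟨u + w, by omega, ?_⟩
  have hmem : (u, w) ∈ Finset.HasAntidiagonal.antidiagonal (u + w) := by simp
  have hlt : ∀ ij ∈ (Finset.HasAntidiagonal.antidiagonal (u + w)).erase (u, w), ‖a ij.1 * d ij.2‖ < A * B := by
    rintro ⟨i, j⟩ hij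
    rw [Finset.mem_erase, Finset.HasAntidiagonal.mem_antidiagonal] at hij
    obtain ⟨hne, hs⟩ := hij
    simp only at hs ⊢
    rw [norm_mul]
    by_cases hi : i < u
    · have : ‖a i‖ < A := lt_of_le_of_ne (ha i) (Nat.find_min ha0 hi)
      calc ‖a i‖ * ‖d j‖ ≤ ‖a i‖ * B := by gcongr; exact hd j
        _ < A * B := by gcongr
    · have hj : j < w := by
        rcases Nat.lt_or_ge u i with h | h
        · omega
        · exact absurd (show (i, j) = (u, w) by ext <;> simp <;> omega) hne
      have : ‖d j‖ < B := lt_of_le_of_ne (hd j) (Nat.find_min hd0 hj)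
      calc ‖a i‖ * ‖d j‖ ≤ A * ‖d j‖ := by gcongr; exact ha i
        _ < A * B := by gcongr
  have hrest : ‖∑ ij ∈ (Finset.HasAntidiagonal.antidiagonal (u + w)).erase (u, w), a ij.1 * d ij.2‖ < A * B := by
    rcases ((Finset.HasAntidiagonal.antidiagonal (u + w)).erase (u, w)).eq_empty_or_nonempty with h | h
    · rw [h]; simp; positivity
    · obtain ⟨i, hi, hle⟩ := IsUltrametricDist.exists_norm_finsetSum_le_of_nonempty h
        (fun ij : ℕ × ℕ => a ij.1 * d ij.2)
      exact hle.trans_lt (hlt i hi)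
  rw [← Finset.add_sum_erase _ _ hmem]
  have hmain : ‖a u * d w‖ = A * B := by rw [norm_mul, hu1, hw1]
  rw [IsUltrametricDist.norm_add_eq_max_of_norm_ne_norm (by rw [hmain]; exact hrest.ne'), hmain,
    max_eq_left hrest.le]

lemma conv_le {p : ℕ} [Fact p.Prime] (a d : ℕ → ℚ_[p]) (A B : ℝ) (hA : 0 < A) (hB : 0 < B)
    (ha : ∀ n, ‖a n‖ ≤ A) (hd : ∀ n, ‖d n‖ ≤ B) (s : ℕ) :
    ‖∑ ij ∈ Finset.HasAntidiagonal.antidiagonal s, a ij.1 * d ij.2‖ ≤ A * B := by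
  apply IsUltrametricDist.norm_sum_le_of_forall_le_of_nonneg (by positivity)
  intro ij _
  rw [norm_mul]
  exact mul_le_mul (ha _) (hd _) (norm_nonneg _) hA.le

lemma unit_pow_norm {p : ℕ} [Fact p.Prime] (m : ℕ) (h : ℤ) (u : (ZMod (p ^ m))ˣ) (hu : u ^ h ≠ 1)
    (l : ℕ) (hl1 : ‖(l : ℚ_[p])‖ = 1) (hl : (l : ZMod (p ^ m)) = u) :
    (p : ℝ) ^ (-m : ℤ) < ‖(l : ℚ_[p]) ^ h - 1‖ := by
  by_contra! hcon
  have hl1' : ‖(l : ℤ_[p])‖ = 1 := by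
    rw [PadicInt.norm_def]; simpa using hl1
  obtain ⟨U, hU⟩ := PadicInt.isUnit_iff.2 hl1'
  have hc : (((U ^ h : ℤ_[p]ˣ) : ℤ_[p]) : ℚ_[p]) = (l : ℚ_[p]) ^ h := by
    have := map_zpow (Units.map (PadicInt.Coe.ringHom (p := p)).toMonoidHom) U h
    have := congrArg (Units.val) this
    rw [Units.val_zpow_eq_zpow_val] at this
    simp only [Units.coe_map] at this
    have h3 : PadicInt.Coe.ringHom ((U ^ h : ℤ_[p]ˣ) : ℤ_[p]) = (l : ℚ_[p]) ^ h := by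
      simpa [hU] using this
    exact h3
  have h1 : ‖((U ^ h : ℤ_[p]ˣ) : ℤ_[p]) - 1‖ ≤ (p : ℝ) ^ (-m : ℤ) := by
    rw [PadicInt.norm_def]; push_cast; rw [hc]; exact hcon
  rw [PadicInt.norm_le_pow_iff_mem_span_pow, ← PadicInt.ker_toZModPow, RingHom.mem_ker, map_sub,
    map_one, sub_eq_zero] at h1
  apply hu
  have h2 : Units.map (PadicInt.toZModPow (p := p) m).toMonoidHom U = u := by
    ext; simp [hU, hl]
  rw [← h2, ← map_zpow]
  apply Units.ext
  exact h1

lemma exists_unit (p : ℕ) [Fact p.Prime] (hodd : Odd p) (m : ℕ) (hm : 1 ≤ m) (h : ℤ)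
    (hh : ¬ ((p : ℤ) - 1) * (p : ℤ) ^ (m - 1) ∣ h) : ∃ u : (ZMod (p ^ m))ˣ, u ^ h ≠ 1 := by
  have hp : p.Prime := Fact.out
  have := ZMod.isCyclic_units_of_prime_pow p hp (by rintro rfl; exact absurd hodd (by decide)) m
  obtain ⟨u, hu⟩ := IsCyclic.exists_generator (α := (ZMod (p ^ m))ˣ)
  refine ⟨u, fun h1 => hh ?_⟩
  have h2 := orderOf_dvd_iff_zpow_eq_one.2 h1
  have : NeZero (p ^ m) := ⟨pow_ne_zero _ hp.ne_zero⟩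
  rw [orderOf_eq_card_of_forall_mem_zpowers hu, Nat.card_eq_fintype_card, ZMod.card_units_eq_totient,
    Nat.totient_prime_pow hp (by omega)] at h2
  have h3 : ((p ^ (m - 1) * (p - 1) : ℕ) : ℤ) = ((p : ℤ) - 1) * (p : ℤ) ^ (m - 1) := by
    push_cast [Nat.cast_sub hp.one_le]; ring
  rwa [h3] at h2

theorem serre_core (p : ℕ) [Fact p.Prime] (hodd : Odd p) (m : ℕ) (hm : 1 ≤ m)
    (k k' : ℤ) (f : ModularForm 𝒮ℒ k) (g : ModularForm 𝒮ℒ k') (a b : ℕ → ℚ)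
    (hfa : ∀ n, (qExpansion 1 f).coeff n = a n) (hgb : ∀ n, (qExpansion 1 g).coeff n = b n)
    (A : ℝ) (hA : 0 < A)
    (hva : ∀ n : ℕ, ‖((a n : ℚ_[p]))‖ ≤ A)
    (s : ℕ) (hs : 1 ≤ s) (hv0 : ‖((a s : ℚ_[p]))‖ = A)
    (hab : ∀ n : ℕ, ‖((a n : ℚ_[p])) - ((b n : ℚ_[p]))‖ ≤ A * (p : ℝ) ^ (-m : ℤ)) :
    ((p : ℤ) - 1) * (p : ℤ) ^ (m - 1) ∣ k' - k := by
  by_contra hcon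
  have hp : p.Prime := Fact.out
  obtain ⟨u, hu⟩ := exists_unit p hodd m hm _ hcon
  have : NeZero (p ^ m) := ⟨pow_ne_zero _ hp.ne_zero⟩
  have hinf := (Nat.infinite_setOfPred_prime_and_eq_mod u.isUnit).sdiff (Set.finite_Iic (max s p))
  set L := hinf.natEmbedding with hL
  have hprime : ∀ i, (L i : ℕ).Prime := fun i => (L i).2.1.1
  have hmod : ∀ i, ((L i : ℕ) : ZMod (p ^ m)) = u := fun i => (L i).2.1.2
  have hgt : ∀ i, max s p < (L i : ℕ) := fun i => by simpa using (L i).2.2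
  have hnorm : ∀ i, ‖((L i : ℕ) : ℚ_[p])‖ = 1 := by
    intro i
    rw [Padic.norm_natCast_eq_one_iff]
    rw [Nat.coprime_primes hp (hprime i)]
    have := hgt i
    have := le_max_right s p
    omega
  have hTf := fun i => exists_hecke f (L i : ℕ) (hprime i)
  have hTg := fun i => exists_hecke g (L i : ℕ) (hprime i)
  choose F hF using hTf
  choose G hG using hTg
  set N := Module.finrank ℂ (ModularForm 𝒮ℒ k × ModularForm 𝒮ℒ k') + 1 with hN
  let Q : ℕ → ℕ → ℚ := fun i n =>
    (a (L i * n) - b (L i * n)) + (if (L i : ℕ) ∣ n then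
      ((L i : ℕ) : ℚ) ^ (k - 1) * a (n / L i) - ((L i : ℕ) : ℚ) ^ (k' - 1) * b (n / L i) else 0)
  have hQ : ∀ i n, (Q i n : ℂ) = coefLin k n (F i) - coefLin k' n (G i) := by
    intro i n
    change _ = (qExpansion 1 (F i)).coeff n - (qExpansion 1 (G i)).coeff n
    rw [hF, hG]
    simp only [hfa, hgb, Q]
    split_ifs <;> push_cast <;> ring
  let B : Matrix (Fin N) (Fin N) ℚ := fun i j => Q j (s * L i)
  have hdet : B.det ≠ 0 := by
    have h1 : (B.map (Rat.castHom ℚ_[p])).det ≠ 0 := by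
      apply padic_det_ne_zero _ (A * (p : ℝ) ^ (-m : ℤ))
      · have : (0 : ℝ) < p := by exact_mod_cast hp.pos
        positivity
      · intro i j hij
        have hnd : ¬ (L j : ℕ) ∣ s * L i := by
          intro hd
          rcases (hprime j).dvd_mul.1 hd with h | h
          · have := Nat.le_of_dvd hs h
            have := hgt j
            have := le_max_left s p
            omega
          · have := (Nat.prime_dvd_prime_iff_eq (hprime j) (hprime i)).1 h
            have := L.injective (Subtype.ext this)
            exact hij (Fin.ext this.symm)
        change ‖((Q j (s * L i) : ℚ) : ℚ_[p])‖ ≤ _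
        simp only [Q, if_neg hnd, add_zero]
        rw [Rat.cast_sub]
        exact hab _
      · intro i
        have hl0 : ((L i : ℕ) : ℚ_[p]) ≠ 0 := by
          rw [← norm_pos_iff, hnorm]; exact one_pos
        have hlpos : 0 < (L i : ℕ) := (hprime i).pos
        have e : ((Q i (s * L i) : ℚ) : ℚ_[p]) =
            (((a (L i * (s * L i)) : ℚ_[p]) - b (L i * (s * L i))) +
              ((L i : ℕ) : ℚ_[p]) ^ (k' - 1) * ((a s : ℚ_[p]) - b s))
            + (-(((L i : ℕ) : ℚ_[p]) ^ (k - 1) * (((L i : ℕ) : ℚ_[p]) ^ (k' - k) - 1) * a s)) := by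
          simp only [Q, if_pos (dvd_mul_left (L i : ℕ) s), Nat.mul_div_cancel s hlpos]
          have : ((L i : ℕ) : ℚ_[p]) ^ (k' - 1)
              = ((L i : ℕ) : ℚ_[p]) ^ (k - 1) * ((L i : ℕ) : ℚ_[p]) ^ (k' - k) := by
            rw [← zpow_add₀ hl0]; congr 1; ring
          push_cast
          rw [this]; ring
        have hsmall : ‖(((a (L i * (s * L i)) : ℚ_[p]) - b (L i * (s * L i))) +
              ((L i : ℕ) : ℚ_[p]) ^ (k' - 1) * ((a s : ℚ_[p]) - b s))‖ ≤ A * (p : ℝ) ^ (-m : ℤ) := by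
          refine (IsUltrametricDist.norm_add_le_max _ _).trans (max_le (hab _) ?_)
          rw [norm_mul, norm_zpow, hnorm, _root_.one_zpow, one_mul]
          exact hab _
        have hbig : A * (p : ℝ) ^ (-m : ℤ) <
            ‖(-(((L i : ℕ) : ℚ_[p]) ^ (k - 1) * (((L i : ℕ) : ℚ_[p]) ^ (k' - k) - 1) * a s))‖ := by
          rw [norm_neg, norm_mul, norm_mul, norm_zpow, hnorm, _root_.one_zpow, one_mul, hv0, mul_comm]
          exact mul_lt_mul_of_pos_right (unit_pow_norm m _ u hu _ (hnorm i) (hmod i)) hA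
        change _ < ‖((Q i (s * L i) : ℚ) : ℚ_[p])‖
        rw [e, IsUltrametricDist.norm_add_eq_max_of_norm_ne_norm (hsmall.trans_lt hbig).ne]
        exact lt_max_of_lt_right hbig
    intro h0
    apply h1
    have := RingHom.map_det (Rat.castHom ℚ_[p]) B
    rw [h0, map_zero] at this
    exact this.symm
  have hdetC : (B.map (Rat.castHom ℂ)).det ≠ 0 := by
    have := RingHom.map_det (Rat.castHom ℂ) B
    change _ = (B.map (Rat.castHom ℂ)).det at this
    rw [← this]
    simpa using hdet
  have hli : ¬ LinearIndependent ℂ (fun j : Fin N => (F j, G j)) := by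
    intro h
    have := h.fintype_card_le_finrank
    simp [hN] at this
  obtain ⟨x, hx, j, hj⟩ := Fintype.not_linearIndependent_iff.1 hli
  apply hdetC
  rw [← Matrix.exists_mulVec_eq_zero_iff]
  refine ⟨x, fun h => hj (congrFun h j), ?_⟩
  ext i
  have h1 := congrArg (fun y : ModularForm 𝒮ℒ k × ModularForm 𝒮ℒ k' =>
    coefLin k (s * L i) y.1 - coefLin k' (s * L i) y.2) hx
  simp only [Prod.fst_sum, Prod.snd_sum, map_sum, Prod.smul_fst, Prod.smul_snd, map_smul,
    Prod.fst_zero, Prod.snd_zero, map_zero, sub_zero, smul_eq_mul] at h1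
  rw [← Finset.sum_sub_distrib] at h1
  change ∑ j : Fin N, ((Q j (s * L i) : ℚ) : ℂ) * x j = 0
  rw [← h1]
  refine Finset.sum_congr rfl fun j _ => ?_
  rw [hQ]; ring

noncomputable def D12 : ModularForm 𝒮ℒ 12 :=
  ModularForm.mcast (by decide) (ModularForm.E₄.pow 3)
    - ModularForm.mcast (by decide) (ModularForm.E₆.pow 2)

lemma D12_q : qExpansion 1 D12 =
    (qExpansion 1 ModularForm.E₄) ^ 3 - (qExpansion 1 ModularForm.E₆) ^ 2 := by
  simp only [D12, FunLike.coe_sub, coe_mcast,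
    ModularForm.qExpansion_sub one_pos one_mem_strictPeriods_SL,
    ModularForm.qExpansion_pow one_pos one_mem_strictPeriods_SL]

lemma E4_int : qExpansion 1 ModularForm.E₄ = PowerSeries.map (Int.castRingHom ℂ)
    (PowerSeries.mk fun n => if n = 0 then 1 else 240 * (ArithmeticFunction.sigma 3 n : ℤ)) := by
  ext n
  have hb : bernoulli 4 = -1/30 := by decide +kernel
  rw [EisensteinSeries.E_qExpansion_coeff _ ⟨2, rfl⟩]
  simp only [PowerSeries.coeff_map, PowerSeries.coeff_mk, hb]
  split_ifs <;> push_cast <;> norm_num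

lemma E6_int : qExpansion 1 ModularForm.E₆ = PowerSeries.map (Int.castRingHom ℂ)
    (PowerSeries.mk fun n => if n = 0 then 1 else -504 * (ArithmeticFunction.sigma 5 n : ℤ)) := by
  ext n
  have hb : bernoulli 6 = 1/42 := by decide +kernel
  rw [EisensteinSeries.E_qExpansion_coeff _ ⟨3, rfl⟩]
  simp only [PowerSeries.coeff_map, PowerSeries.coeff_mk, hb]
  split_ifs <;> push_cast <;> norm_num

lemma D12_int : ∃ d : ℕ → ℤ, (∀ n, (qExpansion 1 D12).coeff n = d n) ∧ d 0 = 0 ∧ d 1 = 1728 := by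
  refine ⟨fun n => PowerSeries.coeff n ((PowerSeries.mk fun n => if n = 0 then 1 else
    240 * (ArithmeticFunction.sigma 3 n : ℤ)) ^ 3 - (PowerSeries.mk fun n => if n = 0 then 1 else
    -504 * (ArithmeticFunction.sigma 5 n : ℤ)) ^ 2), ?_, ?_, ?_⟩
  · intro n
    rw [D12_q, E4_int, E6_int, ← map_pow, ← map_pow, ← map_sub, PowerSeries.coeff_map]
    rfl
  · simp
  · simp [pow_succ, PowerSeries.coeff_mul, Finset.Nat.antidiagonal_succ]

lemma exists_max_norm {p : ℕ} [Fact p.Prime] (d : ℕ → ℤ) (h : d 1 ≠ 0) :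
    ∃ B : ℝ, 0 < B ∧ (∀ n, ‖(d n : ℚ_[p])‖ ≤ B) ∧ ∃ n, ‖(d n : ℚ_[p])‖ = B := by
  classical
  have hp : p.Prime := Fact.out
  have hp0 : (0 : ℝ) < p := by exact_mod_cast hp.pos
  have hp1 : (1 : ℝ) < p := by exact_mod_cast hp.one_lt
  have key : ∀ x : ℤ, x ≠ 0 → ‖(x : ℚ_[p])‖ = (p : ℝ) ^ (-(padicValInt p x : ℤ)) := by
    intro x hx
    rw [Padic.norm_eq_zpow_neg_valuation (by exact_mod_cast hx), Padic.valuation_intCast]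
  have hex : ∃ e : ℕ, ∃ n, d n ≠ 0 ∧ padicValInt p (d n) = e := ⟨_, 1, h, rfl⟩
  obtain ⟨n, hn, he⟩ := Nat.find_spec hex
  refine ⟨‖(d n : ℚ_[p])‖, norm_pos_iff.2 (by exact_mod_cast hn), fun j => ?_, n, rfl⟩
  by_cases hj : d j = 0
  · simp [hj]
  · rw [key _ hj, key _ hn, he]
    apply zpow_le_zpow_right₀ hp1.le
    have := Nat.find_min' hex ⟨j, hj, rfl⟩
    omega

lemma gamma_one_eq : (𝒮ℒ : Subgroup (GL (Fin 2) ℝ)) =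
    ((CongruenceSubgroup.Gamma 1 : Subgroup SL(2, ℤ)) : Subgroup (GL (Fin 2) ℝ)) := by
  rw [CongruenceSubgroup.Gamma_one_top, MonoidHom.range_eq_map]

theorem serre_aux (p : ℕ) [Fact p.Prime] (hodd : Odd p) (m : ℕ) (hm : 1 ≤ m)
    (k k' : ℤ)
    (f : ModularForm (CongruenceSubgroup.Gamma 1) k)
    (g : ModularForm (CongruenceSubgroup.Gamma 1) k')
    (a b : ℕ → ℚ)
    (hfa : HasRationalQExpansion f a) (hgb : HasRationalQExpansion g b)
    (v : ℤ)
    (hva : ∀ n : ℕ, ‖((a n : ℚ_[p]))‖ ≤ (p : ℝ) ^ (-v))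
    (hv0 : ∃ n₀ : ℕ, ‖((a n₀ : ℚ_[p]))‖ = (p : ℝ) ^ (-v))
    (hab : ∀ n : ℕ, ‖((a n : ℚ_[p])) - ((b n : ℚ_[p]))‖ ≤ (p : ℝ) ^ (-(v + (m : ℤ)))) :
    ((p : ℤ) - 1) * (p : ℤ) ^ (m - 1) ∣ k' - k := by
  have hp : p.Prime := Fact.out
  have hp0 : (0 : ℝ) < p := by exact_mod_cast hp.pos
  let f' : ModularForm 𝒮ℒ k := ModularForm.mcast rfl f gamma_one_eq
  let g' : ModularForm 𝒮ℒ k' := ModularForm.mcast rfl g gamma_one_eq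
  have hf' : ∀ n, (qExpansion 1 f').coeff n = a n := fun n => q_unique f' _ hfa n
  have hg' : ∀ n, (qExpansion 1 g').coeff n = b n := fun n => q_unique g' _ hgb n
  obtain ⟨d, hd, hd0, hd1⟩ := D12_int
  obtain ⟨B, hB, hdB, hdB0⟩ := exists_max_norm (p := p) d (by rw [hd1]; norm_num)
  have hA : (0 : ℝ) < (p : ℝ) ^ (-v) := by positivity
  have hF : ∀ n, (qExpansion 1 (f'.mul D12)).coeff n =
      ((∑ ij ∈ Finset.HasAntidiagonal.antidiagonal n, a ij.1 * d ij.2 : ℚ) : ℂ) := by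
    intro n
    rw [ModularForm.qExpansion_mul one_pos one_mem_strictPeriods_SL, PowerSeries.coeff_mul]
    simp only [hf', hd]
    push_cast; rfl
  have hG : ∀ n, (qExpansion 1 (g'.mul D12)).coeff n =
      ((∑ ij ∈ Finset.HasAntidiagonal.antidiagonal n, b ij.1 * d ij.2 : ℚ) : ℂ) := by
    intro n
    rw [ModularForm.qExpansion_mul one_pos one_mem_strictPeriods_SL, PowerSeries.coeff_mul]
    simp only [hg', hd]
    push_cast; rfl
  obtain ⟨s, hs, hs1⟩ := gauss_conv (p := p) (fun n => (a n : ℚ_[p])) (fun n => (d n : ℚ_[p]))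
    _ B hA hB hva hv0 hdB hdB0 (by simp [hd0])
  have := serre_core p hodd m hm _ _ (f'.mul D12) (g'.mul D12) _ _ hF hG ((p : ℝ) ^ (-v) * B)
    (by positivity) ?_ s hs ?_ ?_
  · simpa using this
  · intro n
    have := conv_le (p := p) (fun n => (a n : ℚ_[p])) (fun n => (d n : ℚ_[p]))
      _ B hA hB hva hdB n
    push_cast
    exact this
  · push_cast
    exact hs1
  · intro n
    have := conv_le (p := p) (fun n => (a n : ℚ_[p]) - b n) (fun n => (d n : ℚ_[p]))
      _ B (by positivity) hB hab hdB n
    push_cast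
    rw [← Finset.sum_sub_distrib]
    simp only [sub_mul] at this
    refine this.trans_eq ?_
    rw [neg_add, zpow_add₀ hp0.ne']
    ring

end Helpers

/-- **(Serre, Théorème 1.)** Let `p` be an odd prime, `m ≥ 1`, and let `f, g` be
level-1 modular forms of weights `k, k'` with rational `q`-expansions `(a_n), (b_n)`,
viewed in `ℚ_p`.  If `v_p(f) = v` (i.e. `‖a_n‖_p ≤ p^(-v)` for all `n` with equality
for some `n₀`, so `f ≠ 0`) and `v_p(f - g) ≥ v + m`, then
`k ≡ k' (mod (p-1)·p^(m-1))`. -/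
theorem serre_theoreme_1 (p : ℕ) [Fact p.Prime] (hodd : Odd p) (m : ℕ) (hm : 1 ≤ m)
    (k k' : ℤ)
    (f : ModularForm (CongruenceSubgroup.Gamma 1) k)
    (g : ModularForm (CongruenceSubgroup.Gamma 1) k')
    (a b : ℕ → ℚ)
    (hfa : HasRationalQExpansion f a) (hgb : HasRationalQExpansion g b)
    (v : ℤ)
    (hva : ∀ n : ℕ, ‖((a n : ℚ_[p]))‖ ≤ (p : ℝ) ^ (-v))
    (hv0 : ∃ n₀ : ℕ, ‖((a n₀ : ℚ_[p]))‖ = (p : ℝ) ^ (-v))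
    (hab : ∀ n : ℕ, ‖((a n : ℚ_[p])) - ((b n : ℚ_[p]))‖ ≤ (p : ℝ) ^ (-(v + (m : ℤ)))) :
    k ≡ k' [ZMOD ((p : ℤ) - 1) * (p : ℤ) ^ (m - 1)] := by
  exact Int.modEq_iff_dvd.2 (serre_aux p hodd m hm k k' f g a b hfa hgb v hva hv0 hab)
end
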